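/- Let α ∈ [1/3,1/2]. Then for every x > 0 the value G_α(x) is a positive real number, and the function x ↦ Re(G_α(x)), defined on (0,∞), is hyperbolically completely monotone (HCM). -/

import Mathlib

open MeasureTheory Complex Set Filter

/-- The function `G_α` from Fourati's paper: for `z` in the slit plane,
`G_α(z) = (2πi)⁻¹ ∫_0^∞ (exp(-e^{-iπα} y^α z^{1-α}) - exp(-e^{iπα} y^α z^{1-α})) z⁻¹ e^{-y} dy`,
all complex powers being principal branches. -/
noncomputable def Galpha (α : ℝ) (z : ℂ) : ℂ :=
  (2 * Real.pi * Complex.I)⁻¹ *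
    ∫ y in Set.Ioi (0:ℝ),
      ((Complex.exp (-(Complex.exp (-(Real.pi * α : ℂ) * Complex.I)) * (y:ℂ) ^ (α:ℂ) * z ^ (1 - (α:ℂ))) -
        Complex.exp (-(Complex.exp ((Real.pi * α : ℂ) * Complex.I)) * (y:ℂ) ^ (α:ℂ) * z ^ (1 - (α:ℂ)))) / z) *
      Complex.exp (-(y:ℂ))

/-- The upper boundary value `G_α(-r^+)`. -/
noncomputable def GalphaPlus (α r : ℝ) : ℂ :=
  (2 * Real.pi * Complex.I)⁻¹ *
    ∫ y in Set.Ioi (0:ℝ),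
      ((Complex.exp ((r:ℂ) ^ (1 - (α:ℂ)) * (y:ℂ) ^ (α:ℂ)) -
        Complex.exp (Complex.exp (-(2 * Real.pi * α : ℂ) * Complex.I) * (r:ℂ) ^ (1 - (α:ℂ)) * (y:ℂ) ^ (α:ℂ))) / (r:ℂ)) *
      Complex.exp (-(y:ℂ))

/-- `θ_α(r) = -arg(G_α(-r^+))/π`. -/
noncomputable def thetaFun (α r : ℝ) : ℝ := -(GalphaPlus α r).arg / Real.pi

/-- Zolotarev's integral formula for the density of the strictly `α`-stable
distribution with positivity parameter `ρ` (the integral is a real number; we take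
the real part). -/
noncomputable def stableDensity (α ρ x : ℝ) : ℝ :=
  ((2 * Real.pi * Complex.I)⁻¹ *
    ∫ y in Set.Ioi (0:ℝ),
      ((Complex.exp (-(Complex.exp (-(Real.pi * ρ * α : ℂ) * Complex.I)) * (y:ℂ) ^ (α:ℂ) * (x:ℂ) ^ (-(α:ℂ))) -
        Complex.exp (-(Complex.exp ((Real.pi * ρ * α : ℂ) * Complex.I)) * (y:ℂ) ^ (α:ℂ) * (x:ℂ) ^ (-(α:ℂ)))) / (x:ℂ)) *
      Complex.exp (-(y:ℂ))).re

/-- A function is completely monotone (on `(0,∞)`) if it is infinitely differentiable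
there and `(-1)^n f^{(n)}(x) ≥ 0` for all `n` and `x > 0`. -/
def CompletelyMonotone (φ : ℝ → ℝ) : Prop :=
  ContDiffOn ℝ (⊤ : ℕ∞) φ (Set.Ioi 0) ∧
  ∀ (n : ℕ) (x : ℝ), 0 < x → 0 ≤ (-1 : ℝ) ^ n * iteratedDeriv n φ x

/-- A function `H` on `(0,∞)` is hyperbolically completely monotone if for every `u > 0`
the function `v ↦ H(uv)H(u/v)` is a completely monotone function of `v + 1/v`. -/
def HCM (H : ℝ → ℝ) : Prop :=
  ∀ u : ℝ, 0 < u → ∃ φ : ℝ → ℝ, CompletelyMonotone φ ∧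
    ∀ v : ℝ, 0 < v → H (u * v) * H (u / v) = φ (v + 1 / v)

/-- `AltMono n f`: on `(0,∞)`, `f` is nonnegative and differentiable, with minus its derivative of the
same kind, `n` times over. -/
def AltMono : ℕ → (ℝ → ℝ) → Prop
  | 0, f => ∀ x, 0 < x → 0 ≤ f x
  | n + 1, f => (∀ x, 0 < x → 0 ≤ f x) ∧
      ∃ g : ℝ → ℝ, (∀ x, 0 < x → HasDerivAt f (-g x) x) ∧ AltMono n g

namespace AltMono

theorem of_succ {n : ℕ} {f : ℝ → ℝ} (h : AltMono (n + 1) f) : AltMono n f := by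
  induction n generalizing f with
  | zero => exact h.1
  | succ n ih =>
    obtain ⟨h0, g, hg, hgn⟩ := h
    exact ⟨h0, g, hg, ih hgn⟩

theorem add {n : ℕ} {f g : ℝ → ℝ} (hf : AltMono n f) (hg : AltMono n g) :
    AltMono n (fun x => f x + g x) := by
  induction n generalizing f g with
  | zero => exact fun x hx => add_nonneg (hf x hx) (hg x hx)
  | succ n ih =>
    obtain ⟨hf0, f', hf', hfn⟩ := hf
    obtain ⟨hg0, g', hg', hgn⟩ := hg
    refine ⟨fun x hx => add_nonneg (hf0 x hx) (hg0 x hx), fun x => f' x + g' x, fun x hx => ?_,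
      ih hfn hgn⟩
    exact ((hf' x hx).add (hg' x hx)).congr_deriv (neg_add _ _).symm

theorem mul {n : ℕ} {f g : ℝ → ℝ} (hf : AltMono n f) (hg : AltMono n g) :
    AltMono n (fun x => f x * g x) := by
  induction n generalizing f g with
  | zero => exact fun x hx => mul_nonneg (hf x hx) (hg x hx)
  | succ n ih =>
    have hf1 := hf.of_succ
    have hg1 := hg.of_succ
    obtain ⟨hf0, f', hf', hfn⟩ := hf
    obtain ⟨hg0, g', hg', hgn⟩ := hg
    refine ⟨fun x hx => mul_nonneg (hf0 x hx) (hg0 x hx), fun x => f' x * g x + f x * g' x,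
      fun x hx => ?_, (ih hfn hg1).add (ih hf1 hgn)⟩
    exact ((hf' x hx).mul (hg' x hx)).congr_deriv (by ring)

theorem const {c : ℝ} (hc : 0 ≤ c) (n : ℕ) : AltMono n (fun _ => c) := by
  induction n generalizing c with
  | zero => exact fun _ _ => hc
  | succ n ih =>
    exact ⟨fun _ _ => hc, fun _ => 0, fun x _ => by simpa using hasDerivAt_const x c, ih le_rfl⟩

theorem exp_neg {N ψ : ℝ → ℝ} (hN : ∀ x, 0 < x → HasDerivAt N (ψ x) x)
    (hψ : ∀ n, AltMono n ψ) (n : ℕ) : AltMono n (fun x => Real.exp (-N x)) := by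
  induction n with
  | zero => exact fun x _ => (Real.exp_pos _).le
  | succ n ih =>
    refine ⟨fun x _ => (Real.exp_pos _).le, fun x => ψ x * Real.exp (-N x), fun x hx => ?_,
      (hψ n).mul ih⟩
    exact (hN x hx).neg.exp.congr_deriv (by simp only [Pi.neg_apply]; ring)

theorem contDiffOn {n : ℕ} {f : ℝ → ℝ} (h : AltMono (n + 1) f) :
    ContDiffOn ℝ n f (Ioi 0) := by
  induction n generalizing f with
  | zero =>
    obtain ⟨-, g, hg, -⟩ := h
    exact contDiffOn_zero.2 fun x hx => (hg x hx).continuousAt.continuousWithinAt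
  | succ n ih =>
    obtain ⟨-, g, hg, hgn⟩ := h
    push_cast
    refine (contDiffOn_succ_iff_deriv_of_isOpen isOpen_Ioi).2
      ⟨fun x hx => (hg x hx).differentiableAt.differentiableWithinAt, by simp, ?_⟩
    exact (ih hgn).neg.congr fun x hx => (hg x hx).deriv

theorem iteratedDeriv_nonneg {n : ℕ} {f : ℝ → ℝ} (h : AltMono n f) {x : ℝ} (hx : 0 < x) :
    0 ≤ (-1 : ℝ) ^ n * iteratedDeriv n f x := by
  induction n generalizing f with
  | zero => simpa using h x hx
  | succ n ih =>
    obtain ⟨-, g, hg, hgn⟩ := h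
    have he : deriv f =ᶠ[nhds x] fun y => -g y := by
      filter_upwards [Ioi_mem_nhds hx] with y hy using (hg y hy).deriv
    rw [iteratedDeriv_succ', he.iteratedDeriv_eq n]
    have : iteratedDeriv n (fun y => -g y) x = - iteratedDeriv n g x := iteratedDeriv_neg n g x
    rw [this, pow_succ]
    simpa using ih hgn

theorem completelyMonotone {f : ℝ → ℝ} (h : ∀ n, AltMono n f) : CompletelyMonotone f :=
  ⟨contDiffOn_infty.2 fun n => (h (n + 1)).contDiffOn,
    fun n _ hx => (h n).iteratedDeriv_nonneg hx⟩

end AltMono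

theorem integrable_exp_neg_abs : Integrable (fun τ : ℝ => Real.exp (-|τ|)) := by
  have h1 : IntegrableOn (fun τ : ℝ => Real.exp (-|τ|)) (Ioi 0) :=
    (integrableOn_exp_neg_Ioi 0).congr_fun
      (fun τ hτ => by simp only [abs_of_pos (show (0 : ℝ) < τ from hτ)]) measurableSet_Ioi
  have h2 : IntegrableOn (fun τ : ℝ => Real.exp (-|τ|)) (Iic 0) :=
    (integrableOn_exp_Iic 0).congr_fun
      (fun τ hτ => by simp only [abs_of_nonpos (show τ ≤ 0 from hτ), neg_neg]) measurableSet_Iic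
  rw [← integrableOn_univ, ← Iic_union_Ioi (a := (0 : ℝ))]
  exact h2.union h1

/-- The kernel `e^τ / (e^τ + z)`. -/
noncomputable def logisticKernel (z τ : ℝ) : ℝ := Real.exp τ / (Real.exp τ + z)

theorem abs_logisticKernel_sub_le {z : ℝ} (hz : 0 < z) (τ : ℝ) :
    |logisticKernel z τ - logisticKernel 1 τ| ≤ (1 + z) * (1 + z⁻¹) * Real.exp (-|τ|) := by
  have ht := Real.exp_pos τ
  have he : logisticKernel z τ - logisticKernel 1 τ
      = Real.exp τ * (1 - z) / ((Real.exp τ + z) * (Real.exp τ + 1)) := by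
    unfold logisticKernel
    field_simp
    ring
  have h1 : |1 - z| ≤ 1 + z := by rw [abs_le]; constructor <;> linarith
  rw [he, abs_div, abs_mul, abs_of_pos ht,
    abs_of_pos (show 0 < (Real.exp τ + z) * (Real.exp τ + 1) by positivity), div_le_iff₀ (by positivity)]
  have hzi : z * z⁻¹ = 1 := mul_inv_cancel₀ hz.ne'
  have hzi' : 0 < z⁻¹ := by positivity
  have key : Real.exp τ ≤ (1 + z⁻¹) * Real.exp (-|τ|) * ((Real.exp τ + z) * (Real.exp τ + 1)) := by
    rcases le_total 0 τ with h | h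
    · rw [abs_of_nonneg h, Real.exp_neg]
      have : (1 + z⁻¹) * (Real.exp τ)⁻¹ * ((Real.exp τ + z) * (Real.exp τ + 1))
        = (1 + z⁻¹) * ((Real.exp τ + z) * (1 + (Real.exp τ)⁻¹)) := by field_simp
      rw [this]
      have h2 : 0 < (Real.exp τ)⁻¹ := by positivity
      calc Real.exp τ ≤ 1 * ((Real.exp τ) * 1) := by linarith
        _ ≤ _ := by gcongr <;> linarith
    · rw [abs_of_nonpos h, neg_neg]
      calc Real.exp τ = z⁻¹ * Real.exp τ * (z * 1) := by field_simp
        _ ≤ _ := by gcongr <;> linarith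
  calc Real.exp τ * |1 - z| ≤ ((1 + z⁻¹) * Real.exp (-|τ|) * ((Real.exp τ + z) * (Real.exp τ + 1))) * (1 + z) := by
        gcongr
    _ = _ := by ring

theorem measurable_logisticKernel (z : ℝ) : Measurable (logisticKernel z) :=
  Real.measurable_exp.div (Real.measurable_exp.add_const z)

theorem integrable_mul_logisticKernel_sub {ρ : ℝ → ℝ} (hρm : Measurable ρ)
    {B : ℝ} (hB : ∀ x, |ρ x| ≤ B) {z : ℝ} (hz : 0 < z) :
    Integrable (fun τ => ρ τ * (logisticKernel z τ - logisticKernel 1 τ)) := by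
  refine (integrable_exp_neg_abs.const_mul (B * ((1 + z) * (1 + z⁻¹)))).mono' ?_ ?_
  · exact (hρm.mul ((measurable_logisticKernel z).sub
      (measurable_logisticKernel 1))).aestronglyMeasurable
  · refine Eventually.of_forall fun τ => ?_
    rw [Real.norm_eq_abs, abs_mul, mul_assoc]
    have hB0 : 0 ≤ B := (abs_nonneg _).trans (hB 0)
    exact mul_le_mul (hB τ) (abs_logisticKernel_sub_le hz τ) (abs_nonneg _) hB0

theorem integral_eq_integral_Ioi_add_neg {f : ℝ → ℝ} (hf : Integrable f) :
    ∫ x, f x = ∫ x in Ioi 0, (f x + f (-x)) := by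
  have h := integral_add_compl (measurableSet_Ioi (a := (0 : ℝ))) hf
  have hn : IntegrableOn (fun x => f (-x)) (Ioi 0) := hf.comp_neg.integrableOn
  rw [integral_add hf.integrableOn hn, integral_comp_neg_Ioi, neg_zero, ← h, compl_Ioi]

section Mixture

variable {m : ℝ → ℝ} {B : ℝ}

/-- Mixtures of the functions `w ↦ (2 cosh σ + w)⁻ᵏ` with weight `m`. -/
noncomputable def coshMixture (m : ℝ → ℝ) (k : ℕ) (w : ℝ) : ℝ :=
  ∫ σ in Ioi (0 : ℝ), m σ * ((2 * Real.cosh σ + w) ^ k)⁻¹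

theorem mixture_bound (hB : ∀ σ ∈ Ioi (0 : ℝ), |m σ| ≤ B * Real.exp σ) {k : ℕ} (hk : 2 ≤ k)
    {w : ℝ} (hw : 0 ≤ w) {σ : ℝ} (hσ : σ ∈ Ioi (0 : ℝ)) :
    ‖m σ * ((2 * Real.cosh σ + w) ^ k)⁻¹‖ ≤ B * Real.exp (-σ) := by
  have hq : Real.exp σ ≤ 2 * Real.cosh σ + w := by
    rw [Real.cosh_eq]; have := Real.exp_pos (-σ); linarith
  have he : 1 ≤ Real.exp σ := Real.one_le_exp (le_of_lt hσ)
  have h2 : Real.exp σ ^ 2 ≤ (2 * Real.cosh σ + w) ^ k :=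
    (pow_le_pow_left₀ (by positivity) hq 2).trans (pow_le_pow_right₀ (he.trans hq) hk)
  have hpos : 0 < (2 * Real.cosh σ + w) ^ k := lt_of_lt_of_le (by positivity) h2
  rw [norm_mul, Real.norm_eq_abs, Real.norm_eq_abs, abs_of_pos (inv_pos.2 hpos)]
  calc |m σ| * ((2 * Real.cosh σ + w) ^ k)⁻¹ ≤ (B * Real.exp σ) * (Real.exp σ ^ 2)⁻¹ := by
        gcongr
        · exact (abs_nonneg _).trans (hB σ hσ)
        · exact hB σ hσ
    _ = B * Real.exp (-σ) := by rw [Real.exp_neg]; field_simp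

theorem mixture_measurable (hm : Measurable m) (k : ℕ) (w : ℝ) :
    AEStronglyMeasurable (fun σ => m σ * ((2 * Real.cosh σ + w) ^ k)⁻¹)
      (volume.restrict (Ioi (0 : ℝ))) :=
  (hm.mul ((((Real.measurable_cosh.const_mul 2).add_const w).pow_const k).inv)).aestronglyMeasurable

theorem mixture_integrable (hm : Measurable m) (hB : ∀ σ ∈ Ioi (0 : ℝ), |m σ| ≤ B * Real.exp σ)
    {k : ℕ} (hk : 2 ≤ k) {w : ℝ} (hw : 0 ≤ w) :
    IntegrableOn (fun σ => m σ * ((2 * Real.cosh σ + w) ^ k)⁻¹) (Ioi (0 : ℝ)) :=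
  ((integrableOn_exp_neg_Ioi 0).const_mul B).mono' (mixture_measurable hm k w)
    ((ae_restrict_mem measurableSet_Ioi).mono fun _ hσ => mixture_bound hB hk hw hσ)

theorem coshMixture_hasDerivAt (hm : Measurable m)
    (hB : ∀ σ ∈ Ioi (0 : ℝ), |m σ| ≤ B * Real.exp σ) {k : ℕ} (hk : 2 ≤ k) {w : ℝ} (hw : 0 < w) :
    HasDerivAt (coshMixture m k) (-(k * coshMixture m (k + 1) w)) w := by
  have h := hasDerivAt_integral_of_dominated_loc_of_deriv_le (μ := volume.restrict (Ioi (0 : ℝ)))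
    (F := fun w σ => m σ * ((2 * Real.cosh σ + w) ^ k)⁻¹)
    (F' := fun w σ => -k * (m σ * ((2 * Real.cosh σ + w) ^ (k + 1))⁻¹))
    (bound := fun σ => k * (B * Real.exp (-σ))) (s := Ioi 0) (x₀ := w) (Ioi_mem_nhds hw)
    (Eventually.of_forall fun x => mixture_measurable hm k x)
    (mixture_integrable hm hB hk hw.le)
    ((mixture_measurable hm (k + 1) w).const_mul _)
    ((ae_restrict_mem measurableSet_Ioi).mono fun σ hσ x hx => by
      rw [norm_mul, norm_neg, RCLike.norm_natCast]
      exact mul_le_mul_of_nonneg_left (mixture_bound hB (by omega) (le_of_lt hx) hσ) (by positivity))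
    (((integrableOn_exp_neg_Ioi 0).const_mul B).const_mul _)
    ((ae_restrict_mem measurableSet_Ioi).mono fun σ hσ x hx => by
      have hpos : 0 < 2 * Real.cosh σ + x := by
        have := Real.cosh_pos σ; have : 0 < x := hx; positivity
      have h1 : HasDerivAt (fun x => ((2 * Real.cosh σ + x) ^ k)⁻¹)
          (-(k * (2 * Real.cosh σ + x) ^ (k - 1) * 1) / ((2 * Real.cosh σ + x) ^ k) ^ 2) x :=
        (((hasDerivAt_id x).const_add _).pow k).inv (pow_ne_zero _ hpos.ne')
      refine (h1.const_mul (m σ)).congr_deriv ?_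
      obtain ⟨j, rfl⟩ : ∃ j, k = j + 1 := ⟨k - 1, by omega⟩
      simp only [Nat.add_sub_cancel]
      field_simp
      ring)
  refine h.2.congr_deriv ?_
  rw [integral_const_mul, coshMixture]
  ring

theorem coshMixture_altMono (hm : Measurable m)
    (hB : ∀ σ ∈ Ioi (0 : ℝ), |m σ| ≤ B * Real.exp σ) (hm0 : ∀ σ ∈ Ioi (0 : ℝ), 0 ≤ m σ)
    (n k : ℕ) (hk : 2 ≤ k) : AltMono n (coshMixture m k) := by
  have h0 : ∀ k x, 0 < x → 0 ≤ coshMixture m k x := fun k x hx =>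
    setIntegral_nonneg measurableSet_Ioi fun σ hσ => by
      have := Real.cosh_pos σ
      exact mul_nonneg (hm0 σ hσ) (by positivity)
  induction n generalizing k with
  | zero => exact h0 k
  | succ n ih =>
    exact ⟨h0 k, fun x => k * coshMixture m (k + 1) x,
      fun x hx => coshMixture_hasDerivAt hm hB hk hx,
      (AltMono.const (Nat.cast_nonneg k) n).mul (ih (k + 1) (by omega))⟩

/-- The Bernstein-type primitive of `coshMixture m 2` that vanishes at `2`. -/
noncomputable def coshPrimitive (m : ℝ → ℝ) (w : ℝ) : ℝ :=
  ∫ σ in Ioi (0 : ℝ), m σ * ((2 * Real.cosh σ + 2)⁻¹ - (2 * Real.cosh σ + w)⁻¹)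

theorem coshPrimitive_hasDerivAt (hm : Measurable m)
    (hB : ∀ σ ∈ Ioi (0 : ℝ), |m σ| ≤ B * Real.exp σ) {w : ℝ} (hw : 0 < w) :
    HasDerivAt (coshPrimitive m) (coshMixture m 2 w) w := by
  have hmeas : ∀ x : ℝ, AEStronglyMeasurable
      (fun σ => m σ * ((2 * Real.cosh σ + 2)⁻¹ - (2 * Real.cosh σ + x)⁻¹))
      (volume.restrict (Ioi (0 : ℝ))) := fun x =>
    (hm.mul ((((Real.measurable_cosh.const_mul 2).add_const 2).inv).sub
      (((Real.measurable_cosh.const_mul 2).add_const x).inv))).aestronglyMeasurable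
  have h := hasDerivAt_integral_of_dominated_loc_of_deriv_le (μ := volume.restrict (Ioi (0 : ℝ)))
    (F := fun w σ => m σ * ((2 * Real.cosh σ + 2)⁻¹ - (2 * Real.cosh σ + w)⁻¹))
    (F' := fun w σ => m σ * ((2 * Real.cosh σ + w) ^ 2)⁻¹)
    (bound := fun σ => B * Real.exp (-σ)) (s := Ioi 0) (x₀ := w) (Ioi_mem_nhds hw)
    (Eventually.of_forall hmeas) ?_
    (mixture_measurable hm 2 w)
    ((ae_restrict_mem measurableSet_Ioi).mono fun σ hσ x hx => mixture_bound hB le_rfl (le_of_lt hx) hσ)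
    ((integrableOn_exp_neg_Ioi 0).const_mul B)
    ((ae_restrict_mem measurableSet_Ioi).mono fun σ hσ x hx => by
      have hpos : 0 < 2 * Real.cosh σ + x := by
        have := Real.cosh_pos σ; have : 0 < x := hx; positivity
      have h1 : HasDerivAt (fun x => (2 * Real.cosh σ + x)⁻¹)
          (-1 / (2 * Real.cosh σ + x) ^ 2) x :=
        ((hasDerivAt_id x).const_add _).inv hpos.ne'
      refine ((h1.const_sub _).const_mul (m σ)).congr_deriv ?_
      field_simp)
  · exact h.2
  · refine ((mixture_integrable hm hB le_rfl le_rfl).norm.const_mul |w - 2|).mono' (hmeas w) ?_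
    refine Eventually.of_forall fun σ => ?_
    have hc := Real.cosh_pos σ
    rw [norm_mul, norm_mul, mul_left_comm]
    refine mul_le_mul_of_nonneg_left ?_ (norm_nonneg _)
    have : (2 * Real.cosh σ + 2)⁻¹ - (2 * Real.cosh σ + w)⁻¹
        = (w - 2) * ((2 * Real.cosh σ + 2) * (2 * Real.cosh σ + w))⁻¹ := by
      field_simp; ring
    rw [this, norm_mul, Real.norm_eq_abs]
    refine mul_le_mul_of_nonneg_left ?_ (abs_nonneg _)
    rw [Real.norm_of_nonneg (by positivity), Real.norm_of_nonneg (by positivity)]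
    gcongr
    nlinarith

end Mixture

/-- A function of the form `C exp (-c z + ∫ ρ(τ) (e^τ/(e^τ+z) - e^τ/(e^τ+1)) dτ)` with `ρ` bounded
and nondecreasing is hyperbolically completely monotone. -/
theorem hcm_of_representation {ρ : ℝ → ℝ} (hρ : Monotone ρ) {b : ℝ} (hb : ∀ x, |ρ x| ≤ b)
    {H : ℝ → ℝ} {C c : ℝ} (hc : 0 ≤ c)
    (hH : ∀ z, 0 < z → H z = C * Real.exp (-(c * z) +
      ∫ τ, ρ τ * (logisticKernel z τ - logisticKernel 1 τ))) : HCM H := by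
  intro u hu
  set m : ℝ → ℝ := fun σ => 2 * Real.sinh σ * (ρ (Real.log u + σ) - ρ (Real.log u - σ)) with hmdef
  have hmm : Measurable m :=
    (Real.measurable_sinh.const_mul 2).mul ((hρ.measurable.comp (measurable_const.add measurable_id)).sub
      (hρ.measurable.comp (measurable_const.sub measurable_id)))
  have hm0 : ∀ σ ∈ Ioi (0 : ℝ), 0 ≤ m σ := fun σ hσ => by
    have h1 : 0 ≤ Real.sinh σ := Real.sinh_nonneg_iff.2 (le_of_lt hσ)
    have h2 : ρ (Real.log u - σ) ≤ ρ (Real.log u + σ) := hρ (by have : 0 < σ := hσ; linarith)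
    exact mul_nonneg (by positivity) (by linarith)
  have hmB : ∀ σ ∈ Ioi (0 : ℝ), |m σ| ≤ (2 * b) * Real.exp σ := fun σ hσ => by
    have h1 : 0 ≤ Real.sinh σ := Real.sinh_nonneg_iff.2 (le_of_lt hσ)
    have h2 : 2 * Real.sinh σ ≤ Real.exp σ := by
      rw [Real.sinh_eq]; have := Real.exp_pos (-σ); linarith
    have h3 := abs_le.1 (hb (Real.log u + σ))
    have h4 := abs_le.1 (hb (Real.log u - σ))
    rw [abs_of_nonneg (hm0 σ hσ)]
    calc m σ ≤ 2 * Real.sinh σ * (2 * b) := by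
          apply mul_le_mul_of_nonneg_left _ (by positivity); linarith
      _ ≤ Real.exp σ * (2 * b) := by
          apply mul_le_mul_of_nonneg_right h2; linarith
      _ = _ := by ring
  refine ⟨fun w => H u ^ 2 * Real.exp (-(c * u * (w - 2) + coshPrimitive m w)), ?_, ?_⟩
  · refine AltMono.completelyMonotone fun n => (AltMono.const (sq_nonneg _) n).mul ?_
    refine AltMono.exp_neg (ψ := fun w => c * u + coshMixture m 2 w) (fun w hw => ?_)
      (fun n => (AltMono.const (by positivity) n).add (coshMixture_altMono hmm hmB hm0 n 2 le_rfl)) n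
    exact ((((hasDerivAt_id w).sub_const 2).const_mul (c * u)).congr_deriv (mul_one _)).add
      (coshPrimitive_hasDerivAt hmm hmB hw)
  · intro v hv
    have hintegrable : ∀ z, 0 < z → Integrable (fun τ => ρ τ * (logisticKernel z τ - logisticKernel 1 τ)) :=
      fun z hz => integrable_mul_logisticKernel_sub hρ.measurable hb hz
    set f : ℝ → ℝ := fun τ => ρ τ * (logisticKernel (u * v) τ + logisticKernel (u / v) τ
      - 2 * logisticKernel u τ) with hf
    have hfint : Integrable f := by
      refine (((hintegrable _ (mul_pos hu hv)).add (hintegrable _ (div_pos hu hv))).sub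
        ((hintegrable u hu).const_mul 2)).congr (Eventually.of_forall fun τ => ?_)
      simp only [hf, Pi.add_apply, Pi.sub_apply]
      ring
    have hsum : (∫ τ, ρ τ * (logisticKernel (u * v) τ - logisticKernel 1 τ))
        + (∫ τ, ρ τ * (logisticKernel (u / v) τ - logisticKernel 1 τ))
        = 2 * (∫ τ, ρ τ * (logisticKernel u τ - logisticKernel 1 τ)) + ∫ τ, f τ := by
      rw [← integral_add (hintegrable _ (mul_pos hu hv)) (hintegrable _ (div_pos hu hv)), ← integral_const_mul,
        ← integral_add ((hintegrable u hu).const_mul 2) hfint]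
      congr 1 with τ
      simp only [hf]
      ring
    have hfp : ∫ τ, f τ = - coshPrimitive m (v + 1 / v) := by
      rw [← integral_add_left_eq_self f (Real.log u),
        integral_eq_integral_Ioi_add_neg (hfint.comp_add_left (Real.log u)), coshPrimitive,
        ← integral_neg]
      refine setIntegral_congr_fun measurableSet_Ioi fun σ _ => ?_
      have hk : ∀ σ : ℝ, logisticKernel (u * v) (Real.log u + σ)
          + logisticKernel (u / v) (Real.log u + σ) - 2 * logisticKernel u (Real.log u + σ)
          = - (2 * Real.sinh σ * ((2 * Real.cosh σ + 2)⁻¹ - (2 * Real.cosh σ + (v + 1 / v))⁻¹)) := by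
        intro σ
        have hp := Real.exp_pos σ
        unfold logisticKernel
        rw [Real.exp_add, Real.exp_log hu, Real.sinh_eq, Real.cosh_eq, Real.exp_neg]
        generalize Real.exp σ = p at hp
        have e1 : 2 * ((p + p⁻¹) / 2) + 2 = (p + 1) ^ 2 / p := by field_simp; ring
        have e2 : 2 * ((p + p⁻¹) / 2) + (v + 1 / v) = (p + v) * (p * v + 1) / (p * v) := by
          field_simp; ring
        have e3 : u * p / (u * p + u / v) = p * v / (p * v + 1) := by field_simp
        have e4 : u * p / (u * p + u * v) = p / (p + v) := by field_simp
        have e5 : u * p / (u * p + u) = p / (p + 1) := by field_simp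
        rw [e1, e2, e3, e4, e5]
        field_simp
        ring
      have hk' := hk (-σ)
      rw [Real.sinh_neg, Real.cosh_neg] at hk'
      simp only [hf]
      rw [hk σ, hk']
      simp only [hmdef, sub_eq_add_neg]
      ring
    rw [hfp] at hsum
    rw [hH _ (mul_pos hu hv), hH _ (div_pos hu hv), hH u hu]
    generalize (∫ τ, ρ τ * (logisticKernel (u * v) τ - logisticKernel 1 τ)) = P at hsum
    generalize (∫ τ, ρ τ * (logisticKernel (u / v) τ - logisticKernel 1 τ)) = Q at hsum
    generalize (∫ τ, ρ τ * (logisticKernel u τ - logisticKernel 1 τ)) = R at hsum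
    have hexp : -(c * (u * v)) + P + (-(c * (u / v)) + Q) = (-(c * u) + R) + (-(c * u) + R)
        + -(c * u * (v + 1 / v - 2) + coshPrimitive m (v + 1 / v)) := by
      rw [show -(c * (u * v)) + P + (-(c * (u / v)) + Q) = -(c * (u * v)) - c * (u / v) + (P + Q) by
        ring, hsum]
      ring
    rw [mul_mul_mul_comm, ← Real.exp_add, hexp, Real.exp_add, Real.exp_add]
    ring

section StripRepresentation

variable {M : ℂ → ℂ}

/-- `(M w - M x) e^w / (e^w - e^x)`, with its removable singularity at `x` filled in. -/
noncomputable def stripQuotient (M : ℂ → ℂ) (x w : ℂ) : ℂ :=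
  Complex.exp w * dslope M x w / dslope Complex.exp x w

theorem exp_ne_exp_of_strip {x : ℝ} {w : ℂ} (hw : |w.im| ≤ Real.pi) (hne : w ≠ x) :
    Complex.exp w ≠ Complex.exp x := by
  intro h
  obtain ⟨n, hn⟩ := Complex.exp_eq_exp_iff_exists_int.1 h
  have him : w.im = n * (2 * Real.pi) := by rw [hn]; simp
  have hn0 : n = 0 := by
    by_contra h0
    have h1 : (1 : ℝ) ≤ |(n : ℝ)| := by exact_mod_cast Int.one_le_abs h0
    rw [him, abs_mul, abs_of_pos Real.two_pi_pos] at hw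
    nlinarith [Real.pi_pos]
  exact hne (by rw [hn, hn0]; simp)

theorem stripQuotient_of_ne {x w : ℂ} (hne : w ≠ x) :
    stripQuotient M x w = (M w - M x) * (Complex.exp w / (Complex.exp w - Complex.exp x)) := by
  rw [stripQuotient, dslope_of_ne _ hne, dslope_of_ne _ hne, slope_def_field, slope_def_field]
  have : w - x ≠ 0 := sub_ne_zero.2 hne
  by_cases h : Complex.exp w - Complex.exp x = 0
  · simp [h]
  · field_simp

theorem dslope_exp_ne_zero {x : ℝ} {w : ℂ} (hw : |w.im| ≤ Real.pi) :
    dslope Complex.exp x w ≠ 0 := by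
  by_cases hne : w = x
  · subst hne
    rw [dslope_same]
    simp
  · rw [dslope_of_ne _ hne, slope_def_field]
    exact div_ne_zero (sub_ne_zero.2 (exp_ne_exp_of_strip hw hne)) (sub_ne_zero.2 hne)

theorem stripQuotient_differentiableOn (hd : ∀ w : ℂ, |w.im| ≤ Real.pi → DifferentiableAt ℂ M w)
    {x T : ℝ} (hx : |x| < T) :
    DifferentiableOn ℂ (stripQuotient M x) (uIcc (-T) T ×ℂ uIcc (-Real.pi) Real.pi) := by
  have hT : 0 < T := (abs_nonneg x).trans_lt hx
  have hmem : ∀ w ∈ uIcc (-T) T ×ℂ uIcc (-Real.pi) Real.pi, |w.im| ≤ Real.pi := by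
    intro w hw
    have := hw.2
    rw [mem_preimage, uIcc_of_le (by linarith [Real.pi_pos])] at this
    exact abs_le.2 this
  have hs : uIcc (-T) T ×ℂ uIcc (-Real.pi) Real.pi ∈ nhds (x : ℂ) := by
    rw [uIcc_of_le (by linarith), uIcc_of_le (by linarith [Real.pi_pos])]
    refine mem_of_superset ((isOpen_Ioo.reProdIm isOpen_Ioo).mem_nhds ?_)
      (show Ioo (-T) T ×ℂ Ioo (-Real.pi) Real.pi ⊆ _ from
        reProdIm_subset_iff.2 (prod_mono Ioo_subset_Icc_self Ioo_subset_Icc_self))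
    exact ⟨by simpa using abs_lt.1 hx, by simp [Real.pi_pos]⟩
  refine (differentiable_exp.differentiableOn.mul
    ((Complex.differentiableOn_dslope hs).2 fun w hw =>
      (hd w (hmem w hw)).differentiableWithinAt)).div
    ((Complex.differentiableOn_dslope hs).2 differentiable_exp.differentiableOn) ?_
  exact fun w hw => dslope_exp_ne_zero (hmem w hw)

theorem norm_stripQuotient_sub_le {x T y : ℝ} (hx : x < T) :
    ‖stripQuotient M x (T + y * I) - (M (T + y * I) - M x)‖
      ≤ (‖M (T + y * I)‖ + ‖M x‖) * (Real.exp x / (Real.exp T - Real.exp x)) := by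
  have hne : (T + y * I : ℂ) ≠ x := fun h => by
    have := congrArg re h
    simp at this
    linarith
  have hlt : Real.exp x < Real.exp T := Real.exp_lt_exp.2 hx
  have hn : Real.exp T - Real.exp x ≤ ‖Complex.exp (T + y * I) - Complex.exp x‖ := by
    have := norm_sub_norm_le (Complex.exp (T + y * I)) (Complex.exp x)
    simpa [Complex.norm_exp] using this
  have hne' : Complex.exp (T + y * I) - Complex.exp x ≠ 0 :=
    norm_pos_iff.1 (lt_of_lt_of_le (by linarith) hn)
  have e : stripQuotient M x (T + y * I) - (M (T + y * I) - M x)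
      = (M (T + y * I) - M x) * (Complex.exp x / (Complex.exp (T + y * I) - Complex.exp x)) := by
    rw [stripQuotient_of_ne hne]
    field_simp
    ring
  rw [e, norm_mul, norm_div, Complex.norm_exp, ofReal_re]
  gcongr
  exact norm_sub_le _ _

theorem norm_stripQuotient_le {x T y : ℝ} (hx : T < x) :
    ‖stripQuotient M x (T + y * I)‖
      ≤ (‖M (T + y * I)‖ + ‖M x‖) * (Real.exp T / (Real.exp x - Real.exp T)) := by
  have hne : (T + y * I : ℂ) ≠ x := fun h => by
    have := congrArg re h
    simp at this
    linarith
  have hlt : Real.exp T < Real.exp x := Real.exp_lt_exp.2 hx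
  have hn : Real.exp x - Real.exp T ≤ ‖Complex.exp (T + y * I) - Complex.exp x‖ := by
    have := norm_sub_norm_le (Complex.exp x) (Complex.exp (T + y * I))
    rw [norm_sub_rev] at this
    simpa [Complex.norm_exp] using this
  rw [stripQuotient_of_ne hne, norm_mul, norm_div]
  have : ‖Complex.exp (T + y * I)‖ = Real.exp T := by simp [Complex.norm_exp]
  rw [this]
  gcongr
  exact norm_sub_le _ _

theorem tendsto_linear_mul_exp_div (A B x : ℝ) :
    Tendsto (fun T : ℝ => (A + B * T) * (Real.exp x / (Real.exp T - Real.exp x))) atTop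
      (nhds 0) := by
  have h1 : Tendsto (fun T : ℝ => (A + B * T) * Real.exp (-T)) atTop (nhds 0) := by
    have ha := (Real.tendsto_pow_mul_exp_neg_atTop_nhds_zero 0).const_mul A
    have hb := (Real.tendsto_pow_mul_exp_neg_atTop_nhds_zero 1).const_mul B
    refine ((ha.add hb).congr fun T => ?_).trans (by simp)
    simp
    ring
  have h2 : Tendsto (fun T : ℝ => Real.exp x / (1 - Real.exp x * Real.exp (-T))) atTop
      (nhds (Real.exp x / (1 - Real.exp x * 0))) :=
    tendsto_const_nhds.div (tendsto_const_nhds.sub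
      ((Real.tendsto_exp_neg_atTop_nhds_zero).const_mul _)) (by simp)
  refine ((h1.mul h2).congr fun T => ?_).trans (by simp)
  have : Real.exp T - Real.exp x = Real.exp T * (1 - Real.exp x * Real.exp (-T)) := by
    rw [Real.exp_neg]
    field_simp
  rw [this, Real.exp_neg, mul_assoc, ← div_eq_inv_mul, div_div, mul_comm (Real.exp T)]

theorem stripQuotient_horizontal {x τ : ℝ} {ε : ℂ} (hε : ε = Real.pi * I ∨ ε = -(Real.pi * I)) :
    stripQuotient M x (τ + ε) = (M (τ + ε) - M x) * (logisticKernel (Real.exp x) τ : ℂ) := by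
  have hexp : Complex.exp (τ + ε) = -(Real.exp τ : ℂ) := by
    rcases hε with rfl | rfl
    · rw [Complex.exp_add, Complex.exp_pi_mul_I]; simp
    · rw [Complex.exp_add, Complex.exp_neg, Complex.exp_pi_mul_I]; simp
  have hne : (τ + ε : ℂ) ≠ x := fun h => by
    have := congrArg im h
    rcases hε with rfl | rfl <;> simp [Real.pi_ne_zero] at this
  rw [stripQuotient_of_ne hne, hexp, ← ofReal_exp, logisticKernel]
  push_cast
  congr 1
  rw [← neg_add', neg_div_neg_eq]

/-- Cauchy's formula for the strip `|Im w| ≤ π`, for functions that are real on the real axis and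
grow at most linearly. -/
theorem strip_representation (hd : ∀ w : ℂ, |w.im| ≤ Real.pi → DifferentiableAt ℂ M w)
    (hconj : ∀ w : ℂ, |w.im| ≤ Real.pi → M (starRingEnd ℂ w) = starRingEnd ℂ (M w)) {A B b : ℝ}
    (hM : ∀ w : ℂ, |w.im| ≤ Real.pi → ‖M w‖ ≤ A + B * |w.re|)
    (hb : ∀ τ : ℝ, |(M (τ + Real.pi * I)).im| ≤ b) (x : ℝ) :
    (M x).re - (M 0).re = ∫ τ : ℝ, -((M (τ + Real.pi * I)).im / Real.pi)
      * (logisticKernel (Real.exp x) τ - logisticKernel 1 τ) := by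
  have hpi := Real.pi_pos
  set N : ℂ → ℂ := fun w => stripQuotient M x w - stripQuotient M (0 : ℝ) w with hN
  set g : ℝ → ℝ := fun τ => (M (τ + Real.pi * I)).im *
    (logisticKernel (Real.exp x) τ - logisticKernel 1 τ) with hg
  have hcont : Continuous fun τ : ℝ => (M (τ + Real.pi * I)).im := by
    refine continuous_im.comp (continuous_iff_continuousAt.2 fun τ => ?_)
    exact ContinuousAt.comp (f := fun τ : ℝ => (τ + Real.pi * I : ℂ)) (g := M)
      (hd _ (by simp [abs_of_pos hpi])).continuousAt (by fun_prop)
  have hgint : Integrable g :=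
    integrable_mul_logisticKernel_sub hcont.measurable hb (Real.exp_pos x)
  have hdN : ∀ T : ℝ, |x| < T → DifferentiableOn ℂ N (uIcc (-T) T ×ℂ uIcc (-Real.pi) Real.pi) :=
    fun T hT => (stripQuotient_differentiableOn hd hT).sub (stripQuotient_differentiableOn hd
      (by rw [abs_zero]; exact (abs_nonneg x).trans_lt hT))
  have hrect : ∀ T : ℝ, |x| < T → (-2 * I) * (∫ τ in (-T)..T, (g τ : ℂ))
      + I * (∫ y in (-Real.pi)..Real.pi, N (T + y * I))
      - I * (∫ y in (-Real.pi)..Real.pi, N ((-T : ℝ) + y * I)) = 0 := by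
    intro T hT
    have h := integral_boundary_rect_eq_zero_of_differentiableOn N (-T - Real.pi * I)
      (T + Real.pi * I) (by simpa using hdN T hT)
    have hcN : ∀ ε : ℝ, ε ∈ uIcc (-Real.pi) Real.pi →
        IntervalIntegrable (fun τ : ℝ => N (τ + ε * I)) volume (-T) T := by
      intro ε hε
      refine ContinuousOn.intervalIntegrable ?_
      refine (hdN T hT).continuousOn.comp (by fun_prop) fun τ hτ => ?_
      exact ⟨by simpa using hτ, by simpa using hε⟩
    simp only [sub_re, neg_re, ofReal_re, mul_re, I_re, mul_zero, ofReal_im, I_im, mul_one, sub_self,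
      sub_zero, add_re, add_zero, sub_im, neg_im, neg_zero, mul_im, zero_add, zero_sub, add_im,
      smul_eq_mul] at h
    rw [← intervalIntegral.integral_sub (hcN (-Real.pi) left_mem_uIcc)
      (hcN Real.pi right_mem_uIcc)] at h
    rw [← h, ← intervalIntegral.integral_const_mul]
    congr 3
    funext τ
    have e1 : (τ + ((-Real.pi : ℝ) : ℂ) * I : ℂ) = τ + -(Real.pi * I) := by push_cast; ring
    have e2 : M (τ + -(Real.pi * I)) = starRingEnd ℂ (M (τ + Real.pi * I)) := by
      rw [← hconj _ (by simp [abs_of_pos hpi])]; simp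
    simp only [hN, hg]
    rw [e1, stripQuotient_horizontal (Or.inr rfl), stripQuotient_horizontal (Or.inr rfl),
      stripQuotient_horizontal (Or.inl rfl), stripQuotient_horizontal (Or.inl rfl), e2, Real.exp_zero]
    have e3 : starRingEnd ℂ (M (τ + Real.pi * I))
        = M (τ + Real.pi * I) - 2 * I * ((M (τ + Real.pi * I)).im : ℂ) := by
      apply Complex.ext <;> simp
      ring
    rw [e3]
    push_cast
    ring
  have hbd : ∀ z T : ℝ, |z| < T → ∀ y ∈ Set.uIoc (-Real.pi) Real.pi,
      ‖M (T + y * I)‖ ≤ A + B * T ∧ ‖M ((-T : ℝ) + y * I)‖ ≤ A + B * T := by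
    intro z T hT y hy
    rw [uIoc_of_le (by linarith)] at hy
    have hy' : |y| ≤ Real.pi := abs_le.2 ⟨hy.1.le, hy.2⟩
    have hT0 : 0 < T := (abs_nonneg z).trans_lt hT
    constructor
    · simpa [abs_of_pos hT0] using hM (T + y * I) (by simpa using hy')
    · simpa [abs_of_pos hT0] using hM ((-T : ℝ) + y * I) (by simpa using hy')
  have hright : Tendsto (fun T : ℝ => ∫ y in (-Real.pi)..Real.pi, N (T + y * I)) atTop
      (nhds (2 * Real.pi * (M 0 - M x))) := by
    have hb0 : Tendsto (fun T : ℝ => (((A + ‖M x‖) + B * T) * (Real.exp x / (Real.exp T - Real.exp x))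
        + ((A + ‖M (0 : ℝ)‖) + B * T) * (Real.exp 0 / (Real.exp T - Real.exp 0)))
        * |Real.pi - -Real.pi|) atTop (nhds 0) := by
      simpa using ((tendsto_linear_mul_exp_div (A + ‖M x‖) B x).add
        (tendsto_linear_mul_exp_div (A + ‖M (0 : ℝ)‖) B 0)).mul_const _
    rw [tendsto_iff_norm_sub_tendsto_zero]
    refine squeeze_zero' (Eventually.of_forall fun _ => norm_nonneg _) ?_ hb0
    filter_upwards [eventually_gt_atTop |x|] with T hT
    have hT0 : 0 < T := (abs_nonneg x).trans_lt hT
    have hintegrable : IntervalIntegrable (fun y : ℝ => N (T + y * I)) volume (-Real.pi) Real.pi := by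
      refine ContinuousOn.intervalIntegrable ?_
      refine (hdN T hT).continuousOn.comp (by fun_prop) fun y hy => ?_
      exact ⟨by simp, by simpa using hy⟩
    have hc : (2 * Real.pi * (M 0 - M x) : ℂ) = ∫ y in (-Real.pi)..Real.pi, (M 0 - M x) := by
      rw [intervalIntegral.integral_const, Complex.real_smul]; push_cast; ring
    rw [hc, ← intervalIntegral.integral_sub hintegrable intervalIntegrable_const]
    refine intervalIntegral.norm_integral_le_of_norm_le_const fun y hy => ?_
    have e : N (T + y * I) - (M 0 - M x)
        = (stripQuotient M x (T + y * I) - (M (T + y * I) - M x))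
          - (stripQuotient M (0 : ℝ) (T + y * I) - (M (T + y * I) - M (0 : ℝ))) := by
      simp only [hN, ofReal_zero]; ring
    rw [e]
    refine (norm_sub_le _ _).trans (add_le_add ?_ ?_)
    · refine (norm_stripQuotient_sub_le ((le_abs_self x).trans_lt hT)).trans ?_
      have := Real.exp_lt_exp.2 ((le_abs_self x).trans_lt hT)
      refine mul_le_mul_of_nonneg_right ?_ (div_nonneg (Real.exp_pos _).le (by linarith))
      linarith [(hbd x T hT y hy).1]
    · refine (norm_stripQuotient_sub_le hT0).trans ?_
      have := Real.exp_lt_exp.2 hT0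
      refine mul_le_mul_of_nonneg_right ?_ (div_nonneg (Real.exp_pos _).le (by linarith))
      linarith [(hbd x T hT y hy).1]
  have hleft : Tendsto (fun T : ℝ => ∫ y in (-Real.pi)..Real.pi, N ((-T : ℝ) + y * I)) atTop
      (nhds 0) := by
    have hb0 : Tendsto (fun T : ℝ => (((A + ‖M x‖) + B * T)
          * (Real.exp (-x) / (Real.exp T - Real.exp (-x)))
        + ((A + ‖M (0 : ℝ)‖) + B * T) * (Real.exp (-0) / (Real.exp T - Real.exp (-0))))
        * |Real.pi - -Real.pi|) atTop (nhds 0) := by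
      simpa using ((tendsto_linear_mul_exp_div (A + ‖M x‖) B (-x)).add
        (tendsto_linear_mul_exp_div (A + ‖M (0 : ℝ)‖) B (-0))).mul_const _
    refine squeeze_zero_norm' ?_ hb0
    filter_upwards [eventually_gt_atTop |x|] with T hT
    have hT0 : 0 < T := (abs_nonneg x).trans_lt hT
    have hflip : ∀ z : ℝ, Real.exp (-T) / (Real.exp z - Real.exp (-T))
        = Real.exp (-z) / (Real.exp T - Real.exp (-z)) := by
      intro z
      rw [← mul_div_mul_right _ _ (mul_pos (Real.exp_pos T) (Real.exp_pos (-z))).ne']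
      congr 1
      · rw [← mul_assoc, ← Real.exp_add]; simp
      · rw [sub_mul, ← mul_assoc (Real.exp (-T)), ← Real.exp_add (-T), mul_left_comm, ← Real.exp_add]
        simp
    refine intervalIntegral.norm_integral_le_of_norm_le_const fun y hy => ?_
    have h1 : -T < x := (abs_lt.1 hT).1
    refine (norm_sub_le _ _).trans (add_le_add ?_ ?_)
    · refine (norm_stripQuotient_le h1).trans ?_
      have := Real.exp_lt_exp.2 h1
      rw [← hflip]
      refine mul_le_mul_of_nonneg_right ?_ (div_nonneg (Real.exp_pos _).le (by linarith))
      linarith [(hbd x T hT y hy).2]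
    · refine (norm_stripQuotient_le (by linarith)).trans ?_
      have := Real.exp_lt_exp.2 (show -T < 0 by linarith)
      rw [← hflip]
      refine mul_le_mul_of_nonneg_right ?_ (div_nonneg (Real.exp_pos _).le (by linarith))
      linarith [(hbd x T hT y hy).2]
  have hmid : Tendsto (fun T : ℝ => ∫ τ in (-T)..T, (g τ : ℂ)) atTop (nhds ((∫ τ, g τ : ℝ) : ℂ)) := by
    have h := intervalIntegral_tendsto_integral (hgint.ofReal (𝕜 := ℂ)) tendsto_neg_atTop_atBot
      tendsto_id
    rwa [integral_ofReal] at h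
  have hlim := ((hmid.const_mul (-2 * I)).add (hright.const_mul I)).sub (hleft.const_mul I)
  have hzero : (-2 * I) * ((∫ τ, g τ : ℝ) : ℂ) + I * (2 * Real.pi * (M 0 - M x)) - I * 0 = 0 := by
    refine tendsto_nhds_unique hlim (tendsto_const_nhds.congr' ?_)
    filter_upwards [eventually_gt_atTop |x|] with T hT using (hrect T hT).symm
  have hfin : (∫ τ, g τ) = Real.pi * ((M 0).re - (M x).re) := by
    have h2 : ((∫ τ, g τ : ℝ) : ℂ) = Real.pi * (M 0 - M x) := by
      have : (2 * I) * (((∫ τ, g τ : ℝ) : ℂ) - Real.pi * (M 0 - M x)) = 0 := by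
        linear_combination -hzero
      exact sub_eq_zero.1 ((mul_eq_zero.1 this).resolve_left (by simp))
    have := congrArg re h2
    simpa using this
  have : ∀ τ : ℝ, -((M (τ + Real.pi * I)).im / Real.pi)
      * (logisticKernel (Real.exp x) τ - logisticKernel 1 τ) = (-1 / Real.pi) * g τ := by
    intro τ; simp only [hg]; ring
  simp_rw [this]
  rw [integral_const_mul, hfin]
  field_simp
  ring

end StripRepresentation

section ExpPowIntegral

variable {α : ℝ}

/-- The entire function `κ ↦ ∫₀^∞ exp (-κ y^α - y) dy`. -/
noncomputable def expPowIntegral (α : ℝ) (κ : ℂ) : ℂ :=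
  ∫ y in Ioi (0 : ℝ), Complex.exp (-(κ * (y ^ α : ℝ)) - y)

/-- The critical point of `y ↦ y ^ α - y`. -/
noncomputable def saddlePoint (α : ℝ) : ℝ := α ^ (1 / (1 - α))

/-- The maximum of `y ↦ y ^ α - y`. -/
noncomputable def saddleRate (α : ℝ) : ℝ := saddlePoint α * (1 / α - 1)

theorem saddlePoint_pos (h0 : 0 < α) : 0 < saddlePoint α := Real.rpow_pos_of_pos h0 _

theorem saddlePoint_rpow (h0 : 0 < α) (h1 : α ≤ 1 / 2) : saddlePoint α ^ α = saddlePoint α / α := by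
  have h : saddlePoint α ^ (1 - α) = α := by
    rw [saddlePoint, ← Real.rpow_mul h0.le, one_div_mul_cancel (by linarith), Real.rpow_one]
  have hw := saddlePoint_pos h0
  have : saddlePoint α ^ α = saddlePoint α ^ (1 - (1 - α)) := by ring_nf
  rw [this, Real.rpow_sub hw, Real.rpow_one, h]

theorem saddleRate_nonneg (h0 : 0 < α) (h1 : α ≤ 1 / 2) : 0 ≤ saddleRate α := by
  refine mul_nonneg (saddlePoint_pos h0).le ?_
  rw [sub_nonneg, le_div_iff₀ h0]
  linarith

theorem rpow_le_one_add_sqrt {v : ℝ} (hv : 0 ≤ v) (h0 : 0 < α) (h1 : α ≤ 1 / 2) :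
    v ^ α ≤ 1 + 2 * α * (√v - 1) := by
  have h := rpow_one_add_le_one_add_mul_self (s := √v - 1) (p := 2 * α)
    (by linarith [Real.sqrt_nonneg v]) (by linarith) (by linarith)
  rwa [add_sub_cancel, Real.sqrt_eq_rpow, ← Real.rpow_mul hv, ← mul_assoc,
    one_div_mul_cancel two_ne_zero, one_mul, ← Real.sqrt_eq_rpow] at h

/-- A quadratic improvement of the weighted arithmetic-geometric mean inequality. -/
theorem rpow_mul_rpow_sub_le {X y : ℝ} (hX : 0 ≤ X) (hy : 0 ≤ y) (h0 : 0 < α) (h1 : α ≤ 1 / 2) :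
    X ^ (1 - α) * y ^ α - y ≤ saddleRate α * X - (√y - √(saddlePoint α * X)) ^ 2 := by
  have hw := saddlePoint_pos h0
  rcases hX.eq_or_lt with rfl | hX
  · rw [Real.zero_rpow (by linarith)]
    simp [Real.sq_sqrt hy]
  have hwX : 0 < saddlePoint α * X := mul_pos hw hX
  obtain ⟨v, hv, rfl⟩ : ∃ v, 0 ≤ v ∧ y = saddlePoint α * X * v :=
    ⟨y / (saddlePoint α * X), by positivity, by field_simp⟩
  have hpow : X ^ (1 - α) * (saddlePoint α * X * v) ^ α = X * (saddlePoint α / α) * v ^ α := by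
    rw [Real.mul_rpow hwX.le hv, Real.mul_rpow hw.le hX.le, saddlePoint_rpow h0 h1]
    have : X = X ^ (1 - α) * X ^ α := by rw [← Real.rpow_add hX]; simp
    nth_rw 3 [this]
    ring
  have hb := mul_le_mul_of_nonneg_left (rpow_le_one_add_sqrt hv h0 h1)
    (show 0 ≤ X * (saddlePoint α / α) by positivity)
  rw [hpow, Real.sqrt_mul hwX.le, saddleRate]
  have e1 : √(saddlePoint α * X) ^ 2 = saddlePoint α * X := Real.sq_sqrt hwX.le
  have e2 : √v ^ 2 = v := Real.sq_sqrt hv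
  have e3 : X * (saddlePoint α / α) * (1 + 2 * α * (√v - 1))
      = X * saddlePoint α * (1 / α + 2 * (√v - 1)) := by field_simp
  have e4 : (√(saddlePoint α * X) * √v - √(saddlePoint α * X)) ^ 2
      = saddlePoint α * X * (v - 2 * √v + 1) := by
    linear_combination (√v - 1) ^ 2 * e1 + saddlePoint α * X * e2
  rw [e4]
  nlinarith

theorem integrableOn_exp_mul_rpow_sub (h0 : 0 < α) (h1 : α ≤ 1 / 2) (R : ℝ) :
    IntegrableOn (fun y : ℝ => Real.exp (R * y ^ α - y)) (Ioi 0) := by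
  set X := |R| ^ (1 / (1 - α)) with hX
  have hX0 : 0 ≤ X := by positivity
  have hXR : X ^ (1 - α) = |R| := by
    rw [hX, ← Real.rpow_mul (abs_nonneg R), one_div_mul_cancel (by linarith), Real.rpow_one]
  have hi : IntegrableOn (fun y : ℝ => Real.exp (saddleRate α * X + saddlePoint α * X)
      * Real.exp (-(1 / 2) * y)) (Ioi 0) :=
    (integrableOn_exp_mul_Ioi (by norm_num) 0).const_mul _
  refine Integrable.mono' hi ?_ ?_
  · refine (Measurable.exp ?_).aestronglyMeasurable
    fun_prop
  · filter_upwards [ae_restrict_mem measurableSet_Ioi] with y hy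
    have hy : 0 < y := hy
    rw [Real.norm_eq_abs, abs_of_pos (Real.exp_pos _), ← Real.exp_add]
    refine Real.exp_le_exp.2 ?_
    have hk := rpow_mul_rpow_sub_le hX0 hy.le h0 h1
    rw [hXR] at hk
    have hle : R * y ^ α ≤ |R| * y ^ α :=
      mul_le_mul_of_nonneg_right (le_abs_self R) (by positivity)
    have e1 : √(saddlePoint α * X) ^ 2 = saddlePoint α * X :=
      Real.sq_sqrt (mul_nonneg (saddlePoint_pos h0).le hX0)
    have e2 : √y ^ 2 = y := Real.sq_sqrt hy.le
    nlinarith [sq_nonneg (√y - 2 * √(saddlePoint α * X))]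

theorem norm_exp_neg_mul_rpow_sub (κ : ℂ) (y : ℝ) :
    ‖Complex.exp (-(κ * (y ^ α : ℝ)) - y)‖ = Real.exp (-(κ.re * y ^ α) - y) := by
  rw [Complex.norm_exp]; simp

theorem measurable_exp_neg_mul_rpow_sub (κ : ℂ) :
    Measurable fun y : ℝ => Complex.exp (-(κ * (y ^ α : ℝ)) - y) := by
  fun_prop

theorem integrableOn_expPow (h0 : 0 < α) (h1 : α ≤ 1 / 2) (κ : ℂ) :
    IntegrableOn (fun y : ℝ => Complex.exp (-(κ * (y ^ α : ℝ)) - y)) (Ioi 0) := by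
  refine Integrable.mono' (integrableOn_exp_mul_rpow_sub h0 h1 (-κ.re))
    (measurable_exp_neg_mul_rpow_sub κ).aestronglyMeasurable (Eventually.of_forall fun y => ?_)
  rw [norm_exp_neg_mul_rpow_sub, neg_mul]

theorem differentiable_expPowIntegral (h0 : 0 < α) (h1 : α ≤ 1 / 2) :
    Differentiable ℂ (expPowIntegral α) := by
  intro κ₀
  refine (hasDerivAt_integral_of_dominated_loc_of_deriv_le
    (F := fun κ (y : ℝ) => Complex.exp (-(κ * (y ^ α : ℝ)) - y))
    (F' := fun κ (y : ℝ) => Complex.exp (-(κ * (y ^ α : ℝ)) - y) * -((y ^ α : ℝ) : ℂ))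
    (bound := fun y => Real.exp ((‖κ₀‖ + 2) * y ^ α - y))
    (Metric.ball_mem_nhds κ₀ one_pos)
    (Eventually.of_forall fun κ => (measurable_exp_neg_mul_rpow_sub κ).aestronglyMeasurable)
    (integrableOn_expPow h0 h1 κ₀) ?_ ?_ (integrableOn_exp_mul_rpow_sub h0 h1 _) ?_).2.differentiableAt
  · refine ((measurable_exp_neg_mul_rpow_sub κ₀).mul ?_).aestronglyMeasurable
    fun_prop
  · filter_upwards [ae_restrict_mem measurableSet_Ioi] with y hy κ hκ
    have hy : 0 < y := hy
    have hyα : 0 < y ^ α := by positivity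
    rw [norm_mul, norm_exp_neg_mul_rpow_sub, norm_neg, norm_real, Real.norm_eq_abs,
      abs_of_pos hyα]
    have hκn : -κ.re ≤ ‖κ₀‖ + 1 := by
      have h2 : ‖κ‖ ≤ ‖κ₀‖ + 1 := by
        have := norm_le_norm_add_norm_sub' κ κ₀
        have h3 : ‖κ - κ₀‖ < 1 := by simpa [dist_eq_norm] using hκ
        linarith
      linarith [neg_abs_le κ.re, abs_re_le_norm κ]
    have h3 : y ^ α ≤ Real.exp (y ^ α) := by linarith [Real.add_one_le_exp (y ^ α)]
    calc _ ≤ Real.exp (-(κ.re * y ^ α) - y) * Real.exp (y ^ α) := by gcongr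
      _ ≤ _ := by
        rw [← Real.exp_add]
        refine Real.exp_le_exp.2 ?_
        nlinarith
  · refine Eventually.of_forall fun y κ _ => ?_
    have h := (((hasDerivAt_id κ).mul_const ((y ^ α : ℝ) : ℂ)).neg.sub_const (y : ℂ)).cexp
    exact h.congr_deriv (by simp)

theorem expPowIntegral_conj (κ : ℂ) :
    expPowIntegral α (starRingEnd ℂ κ) = starRingEnd ℂ (expPowIntegral α κ) := by
  rw [expPowIntegral, expPowIntegral, ← integral_conj]
  congr 1
  funext y
  rw [← Complex.exp_conj]
  simp

theorem norm_expPowIntegral_le_one {κ : ℂ} (hκ : 0 ≤ κ.re) : ‖expPowIntegral α κ‖ ≤ 1 := by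
  have : (1 : ℝ) = ∫ y in Ioi (0 : ℝ), Real.exp (-y) := by
    rw [integral_exp_neg_Ioi]; simp
  rw [this]
  refine norm_integral_le_of_norm_le (integrableOn_exp_neg_Ioi 0) ?_
  filter_upwards [ae_restrict_mem measurableSet_Ioi] with y hy
  have hy : 0 < y := hy
  rw [norm_exp_neg_mul_rpow_sub]
  refine Real.exp_le_exp.2 ?_
  have : 0 ≤ κ.re * y ^ α := by positivity
  linarith

theorem integrable_abs_add_mul_exp_neg_sq (a : ℝ) :
    Integrable fun u : ℝ => 2 * (|u| + a) * Real.exp (-u ^ 2) := by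
  have h1 : Integrable fun u : ℝ => u * Real.exp (-1 * u ^ 2) := integrable_mul_exp_neg_mul_sq one_pos
  have h2 : Integrable fun u : ℝ => Real.exp (-1 * u ^ 2) := integrable_exp_neg_mul_sq one_pos
  refine ((h1.abs.const_mul 2).add (h2.const_mul (2 * a))).congr (Eventually.of_forall fun u => ?_)
  simp only [Pi.add_apply, neg_one_mul, abs_mul, abs_of_pos (Real.exp_pos _)]
  ring

theorem exists_integral_exp_neg_sqrt_sub_sq_le : ∃ K : ℝ, 0 ≤ K ∧ ∀ a : ℝ, 0 ≤ a →
    IntegrableOn (fun y : ℝ => Real.exp (-(√y - a) ^ 2)) (Ioi 0) ∧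
    ∫ y in Ioi (0 : ℝ), Real.exp (-(√y - a) ^ 2) ≤ K * (1 + a) := by
  refine ⟨∫ u : ℝ, 2 * (|u| + 1) * Real.exp (-u ^ 2), integral_nonneg fun u => by positivity,
    fun a ha => ?_⟩
  have hpt : ∀ v ∈ Ioi (0 : ℝ), (|(2 : ℝ)| * v ^ ((2 : ℝ) - 1)) • Real.exp (-(√(v ^ (2 : ℝ)) - a) ^ 2)
      = 2 * v * Real.exp (-(v - a) ^ 2) := by
    intro v hv
    have hv : 0 < v := hv
    rw [Real.rpow_two, Real.sqrt_sq hv.le, smul_eq_mul]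
    norm_num
  have hintegrable := (integrable_abs_add_mul_exp_neg_sq a).comp_sub_right a
  have hle : ∀ v ∈ Ioi (0 : ℝ), 2 * v * Real.exp (-(v - a) ^ 2)
      ≤ 2 * (|v - a| + a) * Real.exp (-(v - a) ^ 2) := by
    intro v _
    gcongr
    linarith [le_abs_self (v - a)]
  have hintegrable' : IntegrableOn (fun v : ℝ => 2 * v * Real.exp (-(v - a) ^ 2)) (Ioi 0) := by
    refine Integrable.mono' hintegrable.integrableOn (by fun_prop) ?_
    filter_upwards [ae_restrict_mem measurableSet_Ioi] with v hv
    have hv' : 0 < v := hv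
    rw [Real.norm_eq_abs, abs_of_nonneg (by positivity)]
    exact hle v hv
  constructor
  · rw [← integrableOn_Ioi_comp_rpow_iff (fun y : ℝ => Real.exp (-(√y - a) ^ 2)) two_ne_zero]
    exact hintegrable'.congr_fun (fun v hv => (hpt v hv).symm) measurableSet_Ioi
  rw [← integral_comp_rpow_Ioi (fun y : ℝ => Real.exp (-(√y - a) ^ 2)) two_ne_zero,
    setIntegral_congr_fun measurableSet_Ioi hpt]
  calc _ ≤ ∫ v in Ioi (0 : ℝ), 2 * (|v - a| + a) * Real.exp (-(v - a) ^ 2) :=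
        setIntegral_mono_on hintegrable' hintegrable.integrableOn measurableSet_Ioi hle
    _ ≤ ∫ v : ℝ, 2 * (|v - a| + a) * Real.exp (-(v - a) ^ 2) :=
        setIntegral_le_integral hintegrable (Eventually.of_forall fun v => by simp only [Pi.zero_apply]; positivity)
    _ = ∫ u : ℝ, 2 * (|u| + a) * Real.exp (-u ^ 2) :=
        integral_sub_right_eq_self (fun u => 2 * (|u| + a) * Real.exp (-u ^ 2)) a
    _ ≤ ∫ u : ℝ, (2 * (|u| + 1) * Real.exp (-u ^ 2)) * (1 + a) := by
        refine integral_mono (integrable_abs_add_mul_exp_neg_sq a)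
          ((integrable_abs_add_mul_exp_neg_sq 1).mul_const _) fun u => ?_
        have : |u| + a ≤ (|u| + 1) * (1 + a) := by nlinarith [abs_nonneg u]
        calc _ ≤ 2 * ((|u| + 1) * (1 + a)) * Real.exp (-u ^ 2) := by gcongr
          _ = _ := by ring
    _ = _ := integral_mul_const _ _

theorem exists_norm_expPowIntegral_le (h0 : 0 < α) (h1 : α ≤ 1 / 2) : ∃ K : ℝ, 0 ≤ K ∧
    ∀ (X : ℝ) (κ : ℂ), 0 ≤ X → ‖κ‖ ≤ X ^ (1 - α) →
      ‖expPowIntegral α κ‖ ≤ K * (1 + √X) * Real.exp (saddleRate α * X) := by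
  obtain ⟨K, hK, h⟩ := exists_integral_exp_neg_sqrt_sub_sq_le
  refine ⟨K * (1 + √(saddlePoint α)), by positivity, fun X κ hX hκ => ?_⟩
  obtain ⟨hi, hb⟩ := h √(saddlePoint α * X) (Real.sqrt_nonneg _)
  have hw := saddlePoint_pos h0
  have hstep : ‖expPowIntegral α κ‖ ≤ ∫ y in Ioi (0 : ℝ), Real.exp (saddleRate α * X)
      * Real.exp (-(√y - √(saddlePoint α * X)) ^ 2) := by
    refine norm_integral_le_of_norm_le (hi.const_mul _) ?_
    filter_upwards [ae_restrict_mem measurableSet_Ioi] with y hy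
    have hy : 0 < y := hy
    rw [norm_exp_neg_mul_rpow_sub, ← Real.exp_add]
    refine Real.exp_le_exp.2 ?_
    have hk := rpow_mul_rpow_sub_le hX hy.le h0 h1
    have : -(κ.re * y ^ α) ≤ X ^ (1 - α) * y ^ α := by
      rw [← neg_mul]
      refine mul_le_mul_of_nonneg_right ?_ (by positivity)
      linarith [neg_abs_le κ.re, abs_re_le_norm κ]
    linarith
  refine hstep.trans ?_
  rw [integral_const_mul, mul_comm]
  refine mul_le_mul_of_nonneg_right (hb.trans ?_) (Real.exp_pos _).le
  rw [mul_assoc]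
  refine mul_le_mul_of_nonneg_left ?_ hK
  rw [Real.sqrt_mul hw.le]
  nlinarith [Real.sqrt_nonneg (saddlePoint α), Real.sqrt_nonneg X]

end ExpPowIntegral

section ContourShift

variable {α : ℝ}

theorem continuous_comp_vertical {f : ℂ → ℂ} (hc : ContinuousOn f {z | 0 ≤ z.re}) {x : ℝ}
    (hx : 0 ≤ x) : Continuous fun y : ℝ => f (x + y * I) :=
  hc.comp_continuous (by fun_prop) fun y => by simpa using hx

theorem integrableOn_vertical {f : ℂ → ℂ} (hc : ContinuousOn f {z | 0 ≤ z.re}) {x C δ : ℝ}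
    (hx : 0 ≤ x) (hδ : 0 < δ) (hb : ∀ y : ℝ, 0 ≤ y → ‖f (x + y * I)‖ ≤ C * Real.exp (-δ * y)) :
    IntegrableOn (fun y : ℝ => f (x + y * I)) (Ioi 0) := by
  refine Integrable.mono' ((integrableOn_exp_mul_Ioi (neg_neg_of_pos hδ) 0).const_mul C)
    (continuous_comp_vertical hc hx).aestronglyMeasurable ?_
  filter_upwards [ae_restrict_mem measurableSet_Ioi] with y hy using hb y (le_of_lt hy)

/-- Shifting a vertical half-line of integration from the imaginary axis to `Re z = a`. -/
theorem integral_vertical_shift {f : ℂ → ℂ} {a C δ : ℝ} (ha : 0 < a) (hδ : 0 < δ)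
    (hc : ContinuousOn f {z | 0 ≤ z.re}) (hd : ∀ z : ℂ, 0 < z.re → DifferentiableAt ℂ f z)
    (hb : ∀ x y : ℝ, 0 ≤ x → x ≤ a → 0 ≤ y → ‖f (x + y * I)‖ ≤ C * Real.exp (-δ * y)) :
    (∫ x in (0 : ℝ)..a, f x) + I * (∫ y in Ioi (0 : ℝ), f (a + y * I))
      = I * ∫ y in Ioi (0 : ℝ), f ((0 : ℝ) + y * I) := by
  have hrect : ∀ T : ℝ, 0 ≤ T → (∫ x in (0 : ℝ)..a, f x) - (∫ x in (0 : ℝ)..a, f (x + T * I))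
      + I * (∫ y in (0 : ℝ)..T, f (a + y * I)) - I * (∫ y in (0 : ℝ)..T, f ((0 : ℝ) + y * I)) = 0 := by
    intro T hT
    have h := integral_boundary_rect_eq_zero_of_continuousOn_of_differentiableOn f 0 (a + T * I)
      (hc.mono fun z hz => ?_) fun z hz => (hd z ?_).differentiableWithinAt
    · simpa using h
    · have := hz.1
      simp only [mem_preimage, zero_re, add_re, ofReal_re, mul_re, I_re, mul_zero, ofReal_im, I_im,
        mul_one, sub_self, add_zero, uIcc_of_le ha.le] at this
      exact this.1
    · have := hz.1
      simp only [mem_preimage, zero_re, add_re, ofReal_re, mul_re, I_re, mul_zero, ofReal_im, I_im,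
        mul_one, sub_self, add_zero, min_eq_left ha.le] at this
      exact this.1
  have htop : Tendsto (fun T : ℝ => ∫ x in (0 : ℝ)..a, f (x + T * I)) atTop (nhds 0) := by
    have hlim : Tendsto (fun T : ℝ => C * Real.exp (-δ * T) * |a - 0|) atTop (nhds 0) := by
      have : Tendsto (fun T : ℝ => Real.exp (-δ * T)) atTop (nhds 0) :=
        Real.tendsto_exp_atBot.comp (tendsto_id.const_mul_atTop_of_neg (neg_neg_of_pos hδ))
      simpa using (this.const_mul C).mul_const |a - 0|
    refine squeeze_zero_norm' ?_ hlim
    filter_upwards [eventually_ge_atTop 0] with T hT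
    refine intervalIntegral.norm_integral_le_of_norm_le_const fun x hx => ?_
    rw [uIoc_of_le ha.le] at hx
    exact hb x T hx.1.le hx.2 hT
  have hv : ∀ x : ℝ, 0 ≤ x → x ≤ a → Tendsto (fun T : ℝ => ∫ y in (0 : ℝ)..T, f (x + y * I)) atTop
      (nhds (∫ y in Ioi (0 : ℝ), f (x + y * I))) := fun x hx hxa =>
    intervalIntegral_tendsto_integral_Ioi 0
      (integrableOn_vertical hc hx hδ fun y hy => hb x y hx hxa hy) tendsto_id
  have hlim := (((tendsto_const_nhds (x := ∫ x in (0 : ℝ)..a, f x)).sub htop).add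
    ((hv a ha.le le_rfl).const_mul I)).sub ((hv 0 le_rfl ha.le).const_mul I)
  have := tendsto_nhds_unique hlim (tendsto_const_nhds.congr' (f₁ := fun _ => (0 : ℂ)) ?_)
  · linear_combination this
  · filter_upwards [eventually_ge_atTop 0] with T hT using (hrect T hT).symm

theorem continuousOn_cpow_const {γ : ℝ} (hγ : 0 < γ) :
    ContinuousOn (fun z : ℂ => z ^ (γ : ℂ)) {z | 0 ≤ z.re} := fun _ hz =>
  (continuousAt_cpow_const_of_re_pos (Or.inl hz) (by simpa using hγ)).continuousWithinAt

theorem norm_cpow_le_one_add {z : ℂ} {γ : ℝ} (h0 : 0 < γ) (h1 : γ ≤ 1) :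
    ‖z ^ (γ : ℂ)‖ ≤ 1 + γ * ‖z‖ := by
  have h := rpow_one_add_le_one_add_mul_self (s := ‖z‖ - 1) (p := γ)
    (by linarith [norm_nonneg z]) h0.le h1
  rw [add_sub_cancel] at h
  rw [norm_cpow_real]
  linarith

theorem norm_ofReal_add_mul_I_le {x y a : ℝ} (hx : 0 ≤ x) (hxa : x ≤ a) (hy : 0 ≤ y) :
    ‖(x + y * I : ℂ)‖ ≤ a + y := by
  refine (norm_add_le _ _).trans ?_
  rw [norm_mul, norm_I, mul_one, norm_real, norm_real, Real.norm_eq_abs, Real.norm_eq_abs,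
    abs_of_nonneg hx, abs_of_nonneg hy]
  linarith

theorem hasDerivAt_vertical_cpow {a : ℝ} (ha : 0 < a) (γ t : ℝ) :
    HasDerivAt (fun t : ℝ => (a + t * I : ℂ) ^ (γ : ℂ)) (I * (γ * (a + t * I) ^ ((γ : ℂ) - 1))) t := by
  have h1 : HasDerivAt (fun t : ℝ => (a + t * I : ℂ)) I t := by
    simpa using ((ofRealCLM.hasDerivAt (x := t)).mul_const I).const_add (a : ℂ)
  have h2 := (hasStrictDerivAt_cpow_const (c := (γ : ℂ))
    (show (a + t * I : ℂ) ∈ slitPlane from Or.inl (by simpa using ha))).hasDerivAt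
  exact (h2.scomp t h1).congr_deriv (by rw [smul_eq_mul])

theorem rpow_le_re_vertical_cpow {a γ t : ℝ} (ha : 0 < a) (h0 : 0 ≤ γ) (h1 : γ ≤ 1) (ht : 0 ≤ t) :
    a ^ γ ≤ ((a + t * I : ℂ) ^ (γ : ℂ)).re := by
  have hder : ∀ t : ℝ, HasDerivAt (fun t : ℝ => ((a + t * I : ℂ) ^ (γ : ℂ)).re)
      (I * (γ * (a + t * I) ^ ((γ : ℂ) - 1))).re t := fun t =>
    reCLM.hasFDerivAt.comp_hasDerivAt t (hasDerivAt_vertical_cpow ha γ t)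
  have hmono : MonotoneOn (fun t : ℝ => ((a + t * I : ℂ) ^ (γ : ℂ)).re) (Ici 0) := by
    refine monotoneOn_of_deriv_nonneg (convex_Ici 0)
      (fun t _ => (hder t).continuousAt.continuousWithinAt)
      (fun t _ => (hder t).differentiableAt.differentiableWithinAt) fun t ht => ?_
    rw [interior_Ici] at ht
    have ht : 0 < t := ht
    have hne : (a + t * I : ℂ) ≠ 0 := fun h => by
      have := congrArg re h
      simp at this
      exact ha.ne' this
    have harg0 : 0 ≤ arg (a + t * I) := arg_nonneg_iff.2 (by simpa using ht.le)
    have harg1 := (abs_le.1 (abs_arg_le_pi_div_two_iff (z := a + t * I) |>.2 (by simpa using ha.le))).2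
    have him : ((a + t * I : ℂ) ^ ((γ : ℂ) - 1)).im ≤ 0 := by
      rw [cpow_def_of_ne_zero hne, exp_im]
      refine mul_nonpos_of_nonneg_of_nonpos (Real.exp_pos _).le ?_
      have : (Complex.log (a + t * I) * ((γ : ℂ) - 1)).im = arg (a + t * I) * (γ - 1) := by
        rw [mul_im]; simp [log_im]
      rw [this]
      refine Real.sin_nonpos_of_nonpos_of_neg_pi_le (by nlinarith) (by nlinarith [Real.pi_pos])
    rw [(hder t).deriv]
    simp only [mul_re, I_re, zero_mul, I_im, one_mul, zero_sub, mul_im, ofReal_re, ofReal_im, add_zero]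
    nlinarith
  have h := hmono self_mem_Ici (mem_Ici.2 ht) ht
  simp only [ofReal_zero, zero_mul, add_zero] at h
  rwa [← ofReal_cpow ha.le, ofReal_re] at h

theorem im_vertical_cpow_le (h0 : 0 < α) (h1 : α ≤ 1 / 2) {t : ℝ} (ht : 0 ≤ t) :
    (((1 : ℝ) + t * I : ℂ) ^ (α : ℂ)).im ≤ t / 2 := by
  have hder : ∀ t : ℝ, HasDerivAt (fun t : ℝ => t / 2 - (((1 : ℝ) + t * I : ℂ) ^ (α : ℂ)).im)
      (1 / 2 - (I * (α * ((1 : ℝ) + t * I) ^ ((α : ℂ) - 1))).im) t := fun t =>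
    ((hasDerivAt_id t).div_const 2).sub
      (imCLM.hasFDerivAt.comp_hasDerivAt t (hasDerivAt_vertical_cpow one_pos α t))
  have hmono : Monotone (fun t : ℝ => t / 2 - (((1 : ℝ) + t * I : ℂ) ^ (α : ℂ)).im) := by
    refine monotone_of_deriv_nonneg (fun t => (hder t).differentiableAt) fun t => ?_
    rw [(hder t).deriv, sub_nonneg]
    refine (le_abs_self _).trans ((abs_im_le_norm _).trans ?_)
    have hn : 1 ≤ ‖((1 : ℝ) + t * I : ℂ)‖ := by
      have := abs_re_le_norm ((1 : ℝ) + t * I : ℂ)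
      simpa using this
    have hp : ‖((1 : ℝ) + t * I : ℂ) ^ ((α : ℂ) - 1)‖ ≤ 1 := by
      rw [← ofReal_one, ← ofReal_sub, ofReal_one, norm_cpow_real]
      exact Real.rpow_le_one_of_one_le_of_nonpos hn (by linarith)
    rw [norm_mul, norm_I, one_mul, norm_mul, norm_real, Real.norm_eq_abs, abs_of_pos h0]
    nlinarith
  have h := hmono ht
  simp only [ofReal_zero, zero_mul, add_zero, zero_div, ofReal_one, one_cpow, one_im, sub_zero] at h
  simp only [ofReal_one]
  linarith

theorem ofReal_mul_I_cpow {v γ : ℝ} (hv : 0 < v) :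
    ((0 : ℝ) + v * I : ℂ) ^ (γ : ℂ) = (v ^ γ : ℝ) * Complex.exp (Real.pi * γ / 2 * I) := by
  rw [ofReal_zero, zero_add, cpow_def_of_ne_zero (by simp [hv.ne']), log_ofReal_mul hv I_ne_zero,
    log_I, Real.rpow_def_of_pos hv, ofReal_exp, ← Complex.exp_add]
  push_cast
  ring_nf

theorem expPowIntegral_mul_rpow {X : ℝ} (hX : 0 < X) (κ : ℂ) :
    expPowIntegral α (κ * (X ^ (1 - α) : ℝ))
      = X * ∫ t in Ioi (0 : ℝ), Complex.exp (-(X * (κ * (t ^ α : ℝ) + t))) := by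
  have h := integral_comp_mul_left_Ioi
    (fun y : ℝ => Complex.exp (-(κ * (X ^ (1 - α) : ℝ) * (y ^ α : ℝ)) - y)) 0 hX
  rw [mul_zero, real_smul, ofReal_inv, eq_inv_mul_iff_mul_eq₀ (ofReal_ne_zero.2 hX.ne')] at h
  rw [expPowIntegral, ← h]
  congr 1
  refine setIntegral_congr_fun measurableSet_Ioi fun t ht => ?_
  have ht : 0 < t := ht
  have e : X ^ (1 - α) * (X * t) ^ α = X * t ^ α := by
    rw [Real.mul_rpow hX.le ht.le, ← mul_assoc, ← Real.rpow_add hX]; simp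
  have e' : ((X ^ (1 - α) : ℝ) : ℂ) * ((X * t) ^ α : ℝ) = X * (t ^ α : ℝ) := by exact_mod_cast e
  congr 1
  rw [mul_assoc, e']
  push_cast
  ring

theorem norm_expPowIntegral_imaginary_le (h0 : 0 < α) (h1 : α ≤ 1 / 2) {r : ℝ} (hr : 0 < r) :
    ‖expPowIntegral α (Complex.exp (Real.pi * (1 + α) / 2 * I) * (r ^ (1 - α) : ℝ))‖ ≤ r + 2 := by
  set f : ℂ → ℂ := fun ζ => Complex.exp (I * r * (ζ - ζ ^ (α : ℂ))) with hf
  have hfn : ∀ ζ : ℂ, ‖f ζ‖ = Real.exp (-r * (ζ.im - (ζ ^ (α : ℂ)).im)) := by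
    intro ζ
    rw [hf, Complex.norm_exp]
    simp
  have hc : ContinuousOn f {z | 0 ≤ z.re} := by
    have := continuousOn_cpow_const h0
    fun_prop
  have hd : ∀ z : ℂ, 0 < z.re → DifferentiableAt ℂ f z := by
    intro z hz
    have : z ∈ slitPlane := Or.inl hz
    exact (((differentiableAt_id.sub (differentiableAt_id.cpow_const this))).const_mul _).cexp
  have hb : ∀ x y : ℝ, 0 ≤ x → x ≤ 1 → 0 ≤ y →
      ‖f (x + y * I)‖ ≤ Real.exp (3 / 2 * r) * Real.exp (-(r / 2) * y) := by
    intro x y hx hx1 hy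
    rw [hfn, ← Real.exp_add]
    refine Real.exp_le_exp.2 ?_
    have h3 := ((le_abs_self _).trans (abs_im_le_norm _)).trans
      (norm_cpow_le_one_add (z := x + y * I) h0 (by linarith))
    have h4 := norm_ofReal_add_mul_I_le hx hx1 hy
    have h5 : (x + y * I : ℂ).im = y := by simp
    have h6 : ((x + y * I : ℂ) ^ (α : ℂ)).im ≤ 3 / 2 + y / 2 := by nlinarith [norm_nonneg (x + y * I : ℂ)]
    rw [h5]
    nlinarith
  have hshift := integral_vertical_shift one_pos (half_pos hr) hc hd hb
  have hE : expPowIntegral α (Complex.exp (Real.pi * (1 + α) / 2 * I) * (r ^ (1 - α) : ℝ))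
      = r * ∫ y in Ioi (0 : ℝ), f ((0 : ℝ) + y * I) := by
    rw [expPowIntegral_mul_rpow hr]
    congr 1
    refine setIntegral_congr_fun measurableSet_Ioi fun v hv => ?_
    simp only [hf]
    rw [ofReal_mul_I_cpow hv]
    have : Complex.exp (Real.pi * (1 + α) / 2 * I) = I * Complex.exp (Real.pi * α / 2 * I) := by
      nth_rw 2 [← exp_pi_div_two_mul_I]
      rw [← Complex.exp_add]; ring_nf
    rw [this]
    congr 1
    simp only [ofReal_zero, zero_add]
    linear_combination (-(r : ℂ) * v) * I_sq
  have h1' : ‖∫ x in (0 : ℝ)..1, f x‖ ≤ 1 := by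
    refine (intervalIntegral.norm_integral_le_of_norm_le_const (C := 1) fun x hx => ?_).trans (by simp)
    rw [uIoc_of_le zero_le_one] at hx
    rw [hfn, ← ofReal_cpow hx.1.le]
    simp
  have h2' : ‖∫ y in Ioi (0 : ℝ), f ((1 : ℝ) + y * I)‖ ≤ 2 / r := by
    have hval : ∫ y in Ioi (0 : ℝ), Real.exp (-(r / 2) * y) = 2 / r := by
      rw [integral_exp_mul_Ioi (by linarith)]
      simp
    rw [← hval]
    refine norm_integral_le_of_norm_le (integrableOn_exp_mul_Ioi (by linarith) 0) ?_
    filter_upwards [ae_restrict_mem measurableSet_Ioi] with y hy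
    have hy : 0 < y := hy
    rw [hfn]
    refine Real.exp_le_exp.2 ?_
    have h3 := im_vertical_cpow_le h0 h1 hy.le
    have h5 : ((1 : ℝ) + y * I : ℂ).im = y := by simp
    rw [h5]
    nlinarith
  have hn : ‖∫ y in Ioi (0 : ℝ), f ((0 : ℝ) + y * I)‖ ≤ 1 + 2 / r := by
    have : ‖I * ∫ y in Ioi (0 : ℝ), f ((0 : ℝ) + y * I)‖ ≤ 1 + 2 / r := by
      rw [← hshift]
      refine (norm_add_le _ _).trans (add_le_add h1' ?_)
      rwa [norm_mul, norm_I, one_mul]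
    rwa [norm_mul, norm_I, one_mul] at this
  rw [hE, norm_mul, norm_real, Real.norm_eq_abs, abs_of_pos hr]
  calc _ ≤ r * (1 + 2 / r) := by gcongr
    _ = r + 2 := by field_simp

theorem exists_abs_im_expPowIntegral_le (h0 : 0 < α) (h1 : α ≤ 1 / 2) : ∃ K : ℝ, 0 ≤ K ∧
    ∀ X : ℝ, 1 ≤ X → |(expPowIntegral α (Complex.exp (Real.pi * α * I) * (X ^ (1 - α) : ℝ))).im|
      ≤ K * √X * Real.exp (-(saddleRate α * X)) := by
  set a := √(saddlePoint α) with ha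
  have ha0 : 0 < a := Real.sqrt_pos.2 (saddlePoint_pos h0)
  have ha2 : a ^ 2 = saddlePoint α := Real.sq_sqrt (saddlePoint_pos h0).le
  refine ⟨(a + 1) * √(2 * Real.pi), by positivity, fun X hX => ?_⟩
  have hX0 : 0 < X := by linarith
  have hγ : (0 : ℝ) < 2 * α := by linarith
  set f : ℂ → ℂ := fun η => 2 * η * Complex.exp (X * (η ^ 2 - η ^ ((2 * α : ℝ) : ℂ))) with hf
  have hfn : ∀ x y : ℝ, 0 ≤ x → x ≤ a → 0 ≤ y → ‖f (x + y * I)‖ ≤ 2 * (a + y)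
      * Real.exp (X * (x ^ 2 - y ^ 2 - ((x + y * I : ℂ) ^ ((2 * α : ℝ) : ℂ)).re)) := by
    intro x y hx hxa hy
    rw [hf, norm_mul, Complex.norm_exp, norm_mul]
    refine mul_le_mul ?_ (le_of_eq ?_) (Real.exp_pos _).le (by positivity)
    · have := norm_ofReal_add_mul_I_le hx hxa hy
      simpa using this
    · congr 1
      rw [re_ofReal_mul, sub_re]
      congr 2
      simp [pow_two]
  have hc : ContinuousOn f {z | 0 ≤ z.re} := by
    have := continuousOn_cpow_const hγ
    fun_prop
  have hd : ∀ z : ℂ, 0 < z.re → DifferentiableAt ℂ f z := by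
    intro z hz
    have : z ∈ slitPlane := Or.inl hz
    exact (differentiableAt_id.const_mul 2).mul
      ((((differentiableAt_id.pow 2).sub (differentiableAt_id.cpow_const this))).const_mul _).cexp
  have hb : ∀ x y : ℝ, 0 ≤ x → x ≤ a → 0 ≤ y → ‖f (x + y * I)‖
      ≤ 2 * (a + 1) * Real.exp (X * (a ^ 2 + 1 + a) + (X + 2) ^ 2) * Real.exp (-1 * y) := by
    intro x y hx hxa hy
    refine (hfn x y hx hxa hy).trans ?_
    have h3 := ((neg_le_abs _).trans (abs_re_le_norm _)).trans
      (norm_cpow_le_one_add (z := x + y * I) hγ (by linarith))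
    have h4 := norm_ofReal_add_mul_I_le hx hxa hy
    have h5 : -((x + y * I : ℂ) ^ ((2 * α : ℝ) : ℂ)).re ≤ 1 + a + y := by
      nlinarith [norm_nonneg (x + y * I : ℂ)]
    have h6 : x ^ 2 ≤ a ^ 2 := by gcongr
    have h7 : a + y ≤ (a + 1) * Real.exp y := by
      have := Real.add_one_le_exp y
      nlinarith
    calc _ ≤ 2 * ((a + 1) * Real.exp y) * Real.exp (X * (a ^ 2 + 1 + a) + X * (y - y ^ 2)) := by
          gcongr
          rw [← mul_add]
          exact mul_le_mul_of_nonneg_left (by linarith) hX0.le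
      _ = 2 * (a + 1) * Real.exp (y + (X * (a ^ 2 + 1 + a) + X * (y - y ^ 2))) := by
          rw [Real.exp_add y]; ring
      _ ≤ 2 * (a + 1) * Real.exp (X * (a ^ 2 + 1 + a) + (X + 2) ^ 2 + -1 * y) := by
          refine mul_le_mul_of_nonneg_left (Real.exp_le_exp.2 ?_) (by positivity)
          nlinarith [sq_nonneg (2 * y - (X + 2)), sq_nonneg (X + 2),
            mul_nonneg (sub_nonneg.2 hX) (sq_nonneg y)]
      _ = _ := by rw [Real.exp_add _ (-1 * y)]; ring
  have hshift := integral_vertical_shift ha0 one_pos hc hd hb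
  have hE : expPowIntegral α (Complex.exp (Real.pi * α * I) * (X ^ (1 - α) : ℝ))
      = -(X * (I * ∫ y in Ioi (0 : ℝ), f ((0 : ℝ) + y * I))) := by
    rw [expPowIntegral_mul_rpow hX0, ← mul_neg]
    congr 1
    rw [← integral_comp_rpow_Ioi _ two_ne_zero, ← integral_const_mul, ← integral_neg]
    refine setIntegral_congr_fun measurableSet_Ioi fun v hv => ?_
    have hv : 0 < v := hv
    simp only [hf]
    rw [ofReal_mul_I_cpow hv, ← Real.rpow_mul hv.le, Real.rpow_two]
    have e1 : (2 : ℝ) - 1 = 1 := by norm_num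
    rw [e1, Real.rpow_one, abs_two, real_smul]
    have e2 : (Real.pi * ((2 * α : ℝ) : ℂ) / 2 * I : ℂ) = Real.pi * α * I := by push_cast; ring
    rw [e2]
    have e3 : (X : ℂ) * (((0 : ℝ) + v * I) ^ 2 - (v ^ (2 * α) : ℝ) * Complex.exp (Real.pi * α * I))
        = -(X * (Complex.exp (Real.pi * α * I) * (v ^ (2 * α) : ℝ) + (v ^ 2 : ℝ))) := by
      push_cast
      linear_combination (X * v ^ 2 : ℂ) * I_sq
    rw [e3]
    push_cast
    linear_combination (2 * (v : ℂ) * Complex.exp (-(X * (Complex.exp (Real.pi * α * I)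
      * (v ^ (2 * α) : ℝ) + (v : ℂ) ^ 2)))) * I_sq
  have hreal : (∫ x in (0 : ℝ)..a, f x).im = 0 := by
    have : ∫ x in (0 : ℝ)..a, f x
        = ∫ x in (0 : ℝ)..a, ((2 * x * Real.exp (X * (x ^ 2 - x ^ (2 * α))) : ℝ) : ℂ) := by
      refine intervalIntegral.integral_congr fun x hx => ?_
      rw [uIcc_of_le ha0.le] at hx
      simp only [hf]
      rw [← ofReal_cpow hx.1]
      push_cast
      rfl
    rw [this, intervalIntegral.integral_ofReal, ofReal_im]
  have hright : ‖∫ y in Ioi (0 : ℝ), f (a + y * I)‖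
      ≤ 2 * (a + 1) * Real.exp (-(saddleRate α * X)) * (√(Real.pi / (X / 2)) / 2) := by
    rw [← integral_gaussian_Ioi, ← integral_const_mul]
    refine norm_integral_le_of_norm_le
      (((integrable_exp_neg_mul_sq (half_pos hX0)).integrableOn).const_mul _) ?_
    filter_upwards [ae_restrict_mem measurableSet_Ioi] with y hy
    have hy : 0 < y := hy
    refine (hfn a y ha0.le le_rfl hy.le).trans ?_
    have h3 := rpow_le_re_vertical_cpow ha0 hγ.le (by linarith) hy.le
    have h4 : a ^ (2 * α) = saddlePoint α / α := by
      rw [Real.rpow_mul ha0.le, Real.rpow_two, ha2, saddlePoint_rpow h0 h1]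
    have h5 : a ^ 2 - y ^ 2 - ((a + y * I : ℂ) ^ ((2 * α : ℝ) : ℂ)).re ≤ -saddleRate α - y ^ 2 := by
      rw [saddleRate, ha2]
      rw [h4] at h3
      have : saddlePoint α * (1 / α - 1) = saddlePoint α / α - saddlePoint α := by ring
      linarith
    have h6 : a + y ≤ (a + 1) * Real.exp (X / 2 * y ^ 2) := by
      have h7 := Real.add_one_le_exp (X / 2 * y ^ 2)
      have h8 : y ≤ X / 2 * y ^ 2 + 1 := by nlinarith [sq_nonneg (y - 1)]
      nlinarith [mul_nonneg hX0.le (sq_nonneg y)]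
    calc _ ≤ 2 * ((a + 1) * Real.exp (X / 2 * y ^ 2)) * Real.exp (X * (-saddleRate α - y ^ 2)) := by
          gcongr
      _ = _ := by
          rw [mul_assoc, mul_assoc, ← Real.exp_add, mul_assoc, mul_assoc, ← Real.exp_add]
          ring_nf
  have him : (expPowIntegral α (Complex.exp (Real.pi * α * I) * (X ^ (1 - α) : ℝ))).im
      = -(X * (I * ∫ y in Ioi (0 : ℝ), f (a + y * I)).im) := by
    rw [hE, ← hshift, neg_im, im_ofReal_mul, add_im, hreal, zero_add]
  rw [him, abs_neg, abs_mul, abs_of_pos hX0]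
  have hsq : X * √(Real.pi / (X / 2)) = √(2 * Real.pi) * √X := by
    have : Real.pi / (X / 2) = 2 * Real.pi / X := by field_simp
    rw [this, Real.sqrt_div (by positivity)]
    have hs := Real.mul_self_sqrt hX0.le
    have hs0 : √X ≠ 0 := (Real.sqrt_pos.2 hX0).ne'
    field_simp
    linear_combination -hs
  calc _ ≤ X * (2 * (a + 1) * Real.exp (-(saddleRate α * X)) * (√(Real.pi / (X / 2)) / 2)) := by
        refine mul_le_mul_of_nonneg_left ((abs_im_le_norm _).trans ?_) hX0.le
        rwa [norm_mul, norm_I, one_mul]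
    _ = (a + 1) * Real.exp (-(saddleRate α * X)) * (X * √(Real.pi / (X / 2))) := by ring
    _ = _ := by rw [hsq]; ring

end ContourShift

section PhragmenLindelofStrip

variable {f : ℂ → ℂ} {a b c : ℝ}

theorem diffContOnCl_of_differentiableAt_strip (hab : a < b)
    (hd : ∀ w : ℂ, a ≤ w.im → w.im ≤ b → DifferentiableAt ℂ f w) :
    DiffContOnCl ℂ f (im ⁻¹' Ioo a b) := by
  refine DifferentiableOn.diffContOnCl fun w hw => ?_
  have : closure (im ⁻¹' Ioo a b) = im ⁻¹' Icc a b := by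
    rw [closure_preimage_im, closure_Ioo hab.ne]
  rw [this] at hw
  exact (hd w hw.1 hw.2).differentiableWithinAt

theorem strip_norm_le (hab : a < b)
    (hd : ∀ w : ℂ, a ≤ w.im → w.im ≤ b → DifferentiableAt ℂ f w) {B K C : ℝ}
    (hc : c < Real.pi / (b - a))
    (hB : ∀ w : ℂ, a ≤ w.im → w.im ≤ b → ‖f w‖ ≤ K * Real.exp (B * Real.exp (c * |w.re|)))
    (ha : ∀ w : ℂ, w.im = a → ‖f w‖ ≤ C) (hb : ∀ w : ℂ, w.im = b → ‖f w‖ ≤ C)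
    {w : ℂ} (hwa : a ≤ w.im) (hwb : w.im ≤ b) : ‖f w‖ ≤ C := by
  refine PhragmenLindelof.horizontal_strip (diffContOnCl_of_differentiableAt_strip hab hd)
    ⟨c, hc, B, ?_⟩ ha hb hwa hwb
  refine Asymptotics.IsBigO.of_bound K ?_
  filter_upwards [mem_inf_of_right (mem_principal_self _)] with z hz
  rw [Real.norm_eq_abs, abs_of_pos (Real.exp_pos _)]
  exact hB z hz.1.le hz.2.le

/-- A Phragmén–Lindelöf principle for the sign of the imaginary part. -/
theorem strip_im_nonneg (hab : a < b)
    (hd : ∀ w : ℂ, a ≤ w.im → w.im ≤ b → DifferentiableAt ℂ f w) {K : ℝ}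
    (hc : c < Real.pi / (b - a))
    (hB : ∀ w : ℂ, a ≤ w.im → w.im ≤ b → ‖f w‖ ≤ K * Real.exp (c * |w.re|))
    (ha : ∀ w : ℂ, w.im = a → 0 ≤ (f w).im) (hb : ∀ w : ℂ, w.im = b → 0 ≤ (f w).im)
    {w : ℂ} (hwa : a ≤ w.im) (hwb : w.im ≤ b) : 0 ≤ (f w).im := by
  have hn : ∀ w, ‖Complex.exp (I * f w)‖ = Real.exp (-(f w).im) := fun w => by
    rw [Complex.norm_exp]; simp
  have h := strip_norm_le (f := fun w => Complex.exp (I * f w)) (C := 1) (K := 1) (B := K) hab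
    (fun w h1 h2 => ((hd w h1 h2).const_mul I).cexp) hc (fun w h1 h2 => ?_) (fun w hw => ?_)
    (fun w hw => ?_) hwa hwb
  · rw [hn, Real.exp_le_one_iff] at h
    linarith
  · rw [hn, one_mul]
    exact Real.exp_le_exp.2 (((neg_le_abs _).trans (abs_im_le_norm _)).trans (hB w h1 h2))
  · rw [hn, Real.exp_le_one_iff]
    linarith [ha w hw]
  · rw [hn, Real.exp_le_one_iff]
    linarith [hb w hw]

theorem monotone_re_of_im_nonneg (hb : 0 < b) (hd : ∀ x : ℝ, DifferentiableAt ℂ f x)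
    (hreal : ∀ x : ℝ, (f x).im = 0) (hf : ∀ w : ℂ, 0 ≤ w.im → w.im ≤ b → 0 ≤ (f w).im) :
    Monotone fun x : ℝ => (f x).re := by
  have hder : ∀ x : ℝ, HasDerivAt (fun x : ℝ => (f x).re) (deriv f x).re x := fun x =>
    (hd x).hasDerivAt.real_of_complex
  refine monotone_of_deriv_nonneg (fun x => (hder x).differentiableAt) fun x => ?_
  rw [(hder x).deriv]
  have h1 : HasDerivAt (fun y : ℝ => (x + y * I : ℂ)) I 0 := by
    simpa using ((ofRealCLM.hasDerivAt (x := (0 : ℝ))).mul_const I).const_add (x : ℂ)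
  have h2 : HasDerivAt f (deriv f x) (x + (0 : ℝ) * I) := by simpa using (hd x).hasDerivAt
  have h3 : HasDerivAt (fun y : ℝ => (f (x + y * I)).im) (deriv f x).re 0 := by
    have := imCLM.hasFDerivAt.comp_hasDerivAt (0 : ℝ) (h2.scomp (0 : ℝ) h1)
    exact this.congr_deriv (by simp)
  refine ge_of_tendsto h3.tendsto_slope_zero_right ?_
  filter_upwards [Ioo_mem_nhdsGT hb] with y hy
  simp only [zero_add, ofReal_zero, zero_mul, add_zero, hreal, sub_zero, smul_eq_mul]
  exact mul_nonneg (inv_nonneg.2 hy.1.le)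
    (hf _ (by simpa using hy.1.le) (by simpa using hy.2.le))

end PhragmenLindelofStrip

section StripFun

variable {α : ℝ}

/-- In the coordinate `z = exp w`, this is the entire function `2π z exp (c z) G_α(z)` with
`c = saddleRate α`. -/
noncomputable def stripFun (α : ℝ) (w : ℂ) : ℂ :=
  -I * Complex.exp (saddleRate α * Complex.exp w)
    * (expPowIntegral α (Complex.exp (-(Real.pi * α * I)) * Complex.exp ((1 - α) * w))
      - expPowIntegral α (Complex.exp (Real.pi * α * I) * Complex.exp ((1 - α) * w)))

theorem differentiable_stripFun (h0 : 0 < α) (h1 : α ≤ 1 / 2) : Differentiable ℂ (stripFun α) := by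
  have := differentiable_expPowIntegral h0 h1
  unfold stripFun
  fun_prop

theorem stripFun_conj (w : ℂ) :
    stripFun α (starRingEnd ℂ w) = starRingEnd ℂ (stripFun α w) := by
  have h1 : starRingEnd ℂ (expPowIntegral α (Complex.exp (-(Real.pi * α * I))
      * Complex.exp ((1 - α) * w))) = expPowIntegral α (Complex.exp (Real.pi * α * I)
      * Complex.exp ((1 - α) * starRingEnd ℂ w)) := by
    rw [← expPowIntegral_conj, map_mul, ← Complex.exp_conj, ← Complex.exp_conj]
    simp
  have h2 : starRingEnd ℂ (expPowIntegral α (Complex.exp (Real.pi * α * I)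
      * Complex.exp ((1 - α) * w))) = expPowIntegral α (Complex.exp (-(Real.pi * α * I))
      * Complex.exp ((1 - α) * starRingEnd ℂ w)) := by
    rw [← expPowIntegral_conj, map_mul, ← Complex.exp_conj, ← Complex.exp_conj]
    simp
  rw [stripFun, stripFun, map_mul, map_mul, map_sub, h1, h2, ← Complex.exp_conj, map_neg, conj_I,
    map_mul, conj_ofReal, ← Complex.exp_conj]
  ring

theorem exp_one_sub_mul_eq (x θ : ℝ) : Complex.exp ((1 - α) * (x + θ * I))
    = Complex.exp ((1 - α) * θ * I) * (Real.exp x ^ (1 - α) : ℝ) := by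
  rw [← Real.exp_mul, ofReal_exp, ← Complex.exp_add]
  push_cast
  ring_nf

theorem stripFun_ofReal_add (x θ : ℝ) : stripFun α (x + θ * I)
    = -I * Complex.exp (saddleRate α * Complex.exp (x + θ * I))
      * (expPowIntegral α (Complex.exp (((1 - α) * θ - Real.pi * α : ℝ) * I)
          * (Real.exp x ^ (1 - α) : ℝ))
        - expPowIntegral α (Complex.exp (((1 - α) * θ + Real.pi * α : ℝ) * I)
          * (Real.exp x ^ (1 - α) : ℝ))) := by
  rw [stripFun, exp_one_sub_mul_eq, ← mul_assoc, ← mul_assoc, ← Complex.exp_add, ← Complex.exp_add]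
  push_cast
  ring_nf

theorem stripFun_ofReal (x : ℝ) : stripFun α x
    = ((-2 * Real.exp (saddleRate α * Real.exp x) * (expPowIntegral α
      (Complex.exp (Real.pi * α * I) * (Real.exp x ^ (1 - α) : ℝ))).im : ℝ) : ℂ) := by
  have h := stripFun_ofReal_add (α := α) x 0
  have e : expPowIntegral α (Complex.exp (((1 - α) * 0 - Real.pi * α : ℝ) * I)
      * (Real.exp x ^ (1 - α) : ℝ)) = starRingEnd ℂ (expPowIntegral α
      (Complex.exp (((1 - α) * 0 + Real.pi * α : ℝ) * I) * (Real.exp x ^ (1 - α) : ℝ))) := by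
    rw [← expPowIntegral_conj, map_mul, ← Complex.exp_conj]
    simp
  rw [e, ← neg_sub, sub_conj] at h
  simp only [ofReal_zero, zero_mul, add_zero, mul_zero, zero_add] at h
  rw [h]
  push_cast
  linear_combination (2 * Complex.exp (saddleRate α * Complex.exp x) * ((expPowIntegral α
      (Complex.exp (Real.pi * α * I) * (Real.exp x ^ (1 - α) : ℝ))).im : ℂ)) * I_sq

theorem norm_exp_mul_I_mul {t s : ℝ} (hs : 0 ≤ s) : ‖Complex.exp (t * I) * (s : ℂ)‖ = s := by
  rw [norm_mul, norm_exp_ofReal_mul_I, one_mul, norm_real, Real.norm_eq_abs, abs_of_nonneg hs]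

theorem re_exp_mul_I_mul_nonneg {t s : ℝ} (hs : 0 ≤ s) (ht : |t| ≤ Real.pi / 2) :
    0 ≤ (Complex.exp (t * I) * (s : ℂ)).re := by
  rw [re_mul_ofReal, exp_ofReal_mul_I_re]
  exact mul_nonneg (Real.cos_nonneg_of_neg_pi_div_two_le_of_le (abs_le.1 ht).1 (abs_le.1 ht).2) hs

theorem norm_exp_mul_exp (c x θ : ℝ) : ‖Complex.exp (c * Complex.exp (x + θ * I))‖
    = Real.exp (c * (Real.exp x * Real.cos θ)) := by
  rw [Complex.norm_exp, re_ofReal_mul, Complex.exp_re]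
  simp

theorem norm_stripFun_le {x θ p q r : ℝ} (hp : Real.exp (saddleRate α * (Real.exp x * Real.cos θ)) ≤ p)
    (hq : ‖expPowIntegral α (Complex.exp (((1 - α) * θ - Real.pi * α : ℝ) * I)
          * (Real.exp x ^ (1 - α) : ℝ))‖ ≤ q)
    (hr : ‖expPowIntegral α (Complex.exp (((1 - α) * θ + Real.pi * α : ℝ) * I)
          * (Real.exp x ^ (1 - α) : ℝ))‖ ≤ r) : ‖stripFun α (x + θ * I)‖ ≤ p * (q + r) := by
  rw [stripFun_ofReal_add, norm_mul, norm_mul, norm_neg, norm_I, one_mul, norm_exp_mul_exp]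
  exact mul_le_mul hp ((norm_sub_le _ _).trans (add_le_add hq hr)) (norm_nonneg _)
    ((Real.exp_pos _).le.trans hp)

theorem exists_norm_stripFun_le_of_nonpos (h0 : 0 < α) (h1 : α ≤ 1 / 2) : ∃ C : ℝ, 0 ≤ C ∧
    ∀ x θ : ℝ, x ≤ 0 → ‖stripFun α (x + θ * I)‖ ≤ C * Real.exp (x / 2) := by
  have hE := differentiable_expPowIntegral h0 h1
  obtain ⟨L, hL⟩ := (isCompact_closedBall (0 : ℂ) 1).exists_bound_of_continuousOn
    (hE.contDiff (n := 1)).continuous_deriv_one.continuousOn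
  have hL0 : 0 ≤ L := (norm_nonneg _).trans (hL 0 (by simp))
  refine ⟨Real.exp (saddleRate α) * (L * 2), by positivity, fun x θ hx => ?_⟩
  have hs0 : 0 ≤ Real.exp x ^ (1 - α) := by positivity
  have hs1 : Real.exp x ^ (1 - α) ≤ 1 :=
    Real.rpow_le_one (Real.exp_pos x).le (Real.exp_le_one_iff.2 hx) (by linarith)
  have hs2 : Real.exp x ^ (1 - α) ≤ Real.exp (x / 2) := by
    rw [← Real.exp_mul]
    exact Real.exp_le_exp.2 (by nlinarith)
  have hmem : ∀ t : ℝ, Complex.exp (t * I) * (Real.exp x ^ (1 - α) : ℝ) ∈ Metric.closedBall (0 : ℂ) 1 := by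
    intro t
    rw [mem_closedBall_zero_iff, norm_exp_mul_I_mul hs0]
    exact hs1
  rw [stripFun_ofReal_add, norm_mul, norm_mul, norm_neg, norm_I, one_mul, norm_exp_mul_exp, mul_assoc]
  refine mul_le_mul (Real.exp_le_exp.2 ?_) ?_ (norm_nonneg _) (Real.exp_pos _).le
  · have h2 : Real.exp x * Real.cos θ ≤ 1 :=
      (mul_le_of_le_one_right (Real.exp_pos x).le (Real.cos_le_one θ)).trans
        (Real.exp_le_one_iff.2 hx)
    nlinarith [saddleRate_nonneg h0 h1]
  · refine ((convex_closedBall (0 : ℂ) 1).norm_image_sub_le_of_norm_deriv_le (fun z _ => hE z) hL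
      (hmem _) (hmem _)).trans ?_
    rw [mul_assoc]
    refine mul_le_mul_of_nonneg_left ((norm_sub_le _ _).trans ?_) hL0
    rw [norm_exp_mul_I_mul hs0, norm_exp_mul_I_mul hs0]
    linarith

theorem exists_norm_stripFun_le_exp_exp (h0 : 0 < α) (h1 : α ≤ 1 / 2) : ∃ K B : ℝ, 0 ≤ K ∧ 0 ≤ B ∧
    ∀ w : ℂ, ‖stripFun α w‖ ≤ K * Real.exp (B * Real.exp |w.re|) := by
  obtain ⟨K, hK, hE⟩ := exists_norm_expPowIntegral_le h0 h1
  have hc := saddleRate_nonneg h0 h1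
  refine ⟨4 * K, 2 * saddleRate α + 1, by positivity, by positivity, fun w => ?_⟩
  obtain ⟨x, θ, rfl⟩ : ∃ x θ : ℝ, w = x + θ * I := ⟨w.re, w.im, (re_add_im w).symm⟩
  have hX := Real.exp_pos x
  have hs0 : 0 ≤ Real.exp x ^ (1 - α) := by positivity
  have hre : (x + θ * I : ℂ).re = x := by simp
  have hb : ∀ t : ℝ, ‖expPowIntegral α (Complex.exp (t * I) * (Real.exp x ^ (1 - α) : ℝ))‖
      ≤ K * (1 + √(Real.exp x)) * Real.exp (saddleRate α * Real.exp x) := fun t =>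
    hE _ _ hX.le (norm_exp_mul_I_mul hs0).le
  have h := norm_stripFun_le (p := Real.exp (saddleRate α * Real.exp x)) (Real.exp_le_exp.2
    (mul_le_mul_of_nonneg_left (mul_le_of_le_one_right hX.le (Real.cos_le_one θ)) hc))
    (hb _) (hb _)
  refine h.trans ?_
  rw [hre]
  have h2 : √(Real.exp x) ≤ Real.exp (Real.exp x) := by
    rw [← Real.exp_half]
    refine Real.exp_le_exp.2 ?_
    linarith [Real.add_one_le_exp x, Real.add_one_le_exp (x / 2), Real.exp_pos x]
  have h3 : (1 : ℝ) ≤ Real.exp (Real.exp x) := Real.one_le_exp hX.le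
  calc _ = K * (2 * (1 + √(Real.exp x))) * (Real.exp (saddleRate α * Real.exp x)
          * Real.exp (saddleRate α * Real.exp x)) := by ring
    _ ≤ K * (2 * (Real.exp (Real.exp x) + Real.exp (Real.exp x)))
          * (Real.exp (saddleRate α * Real.exp x) * Real.exp (saddleRate α * Real.exp x)) := by gcongr
    _ = 4 * K * Real.exp ((2 * saddleRate α + 1) * Real.exp x) := by
      rw [← Real.exp_add, add_mul, Real.exp_add _ (1 * Real.exp x), one_mul]
      ring_nf
    _ ≤ _ := by
      gcongr
      exact le_abs_self x

theorem exists_norm_stripFun_line_zero_le (h0 : 0 < α) (h1 : α ≤ 1 / 2) : ∃ C : ℝ, 0 ≤ C ∧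
    ∀ x : ℝ, ‖stripFun α (x + (0 : ℝ) * I)‖ ≤ C * Real.exp (x / 2) := by
  obtain ⟨C, hC, hneg⟩ := exists_norm_stripFun_le_of_nonpos h0 h1
  obtain ⟨K, hK, hpos⟩ := exists_abs_im_expPowIntegral_le h0 h1
  refine ⟨C + 2 * K, by positivity, fun x => ?_⟩
  have he := Real.exp_pos (x / 2)
  rcases le_total x 0 with hx | hx
  · nlinarith [hneg x 0 hx]
  · have h := hpos (Real.exp x) (Real.one_le_exp hx)
    rw [ofReal_zero, zero_mul, add_zero, stripFun_ofReal, norm_real, Real.norm_eq_abs, abs_mul,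
      abs_mul, abs_of_pos (Real.exp_pos _), abs_neg, abs_two]
    rw [← Real.exp_half] at h
    calc _ ≤ 2 * Real.exp (saddleRate α * Real.exp x)
          * (K * Real.exp (x / 2) * Real.exp (-(saddleRate α * Real.exp x))) := by gcongr
      _ = 2 * K * Real.exp (x / 2) * (Real.exp (saddleRate α * Real.exp x)
          * Real.exp (-(saddleRate α * Real.exp x))) := by ring
      _ ≤ _ := by
        rw [← Real.exp_add, add_neg_cancel, Real.exp_zero, mul_one]
        nlinarith

theorem exists_norm_stripFun_line_half_pi_le (h0 : 0 < α) (h1 : α ≤ 1 / 2) : ∃ C : ℝ, 0 ≤ C ∧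
    ∀ x : ℝ, ‖stripFun α (x + (Real.pi / 2 : ℝ) * I)‖
      ≤ C * Real.exp (x / 2) * max 1 (Real.exp x) := by
  obtain ⟨C, hC, hneg⟩ := exists_norm_stripFun_le_of_nonpos h0 h1
  refine ⟨C + 4, by positivity, fun x => ?_⟩
  have he := Real.exp_pos (x / 2)
  have hpi := Real.pi_pos
  rcases le_total x 0 with hx | hx
  · rw [max_eq_left (Real.exp_le_one_iff.2 hx)]
    nlinarith [hneg x (Real.pi / 2) hx]
  · have hX : 1 ≤ Real.exp x := Real.one_le_exp hx
    have h2 := norm_expPowIntegral_imaginary_le h0 h1 (Real.exp_pos x)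
    have e : (Real.pi * (1 + α) / 2 * I : ℂ)
        = ((1 - α) * (Real.pi / 2) + Real.pi * α : ℝ) * I := by push_cast; ring
    rw [e] at h2
    have h3 : ‖expPowIntegral α (Complex.exp (((1 - α) * (Real.pi / 2) - Real.pi * α : ℝ) * I)
          * (Real.exp x ^ (1 - α) : ℝ))‖ ≤ 1 := by
      refine norm_expPowIntegral_le_one (re_exp_mul_I_mul_nonneg (by positivity) ?_)
      rw [abs_le]
      constructor <;> nlinarith
    have h := norm_stripFun_le (x := x) (θ := Real.pi / 2) (p := 1) (by simp) h3 h2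
    rw [max_eq_right hX]
    have h4 : 1 ≤ Real.exp (x / 2) := Real.one_le_exp (by linarith)
    refine h.trans ?_
    nlinarith [mul_nonneg hC (mul_nonneg he.le (Real.exp_pos x).le)]

theorem exists_norm_stripFun_line_pi_le (h0 : 0 < α) (h1 : α ≤ 1 / 2) (h2 : 1 / 3 ≤ α) :
    ∃ C : ℝ, 0 ≤ C ∧ ∀ x : ℝ, ‖stripFun α (x + Real.pi * I)‖ ≤ C * Real.exp (x / 2) := by
  obtain ⟨C, hC, hneg⟩ := exists_norm_stripFun_le_of_nonpos h0 h1
  obtain ⟨K, hK, hE⟩ := exists_norm_expPowIntegral_le h0 h1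
  refine ⟨C + (1 + 2 * K), by positivity, fun x => ?_⟩
  have he := Real.exp_pos (x / 2)
  have hpi := Real.pi_pos
  rcases le_total x 0 with hx | hx
  · nlinarith [hneg x Real.pi hx]
  · have hs0 : 0 ≤ Real.exp x ^ (1 - α) := by positivity
    have h3 : ‖expPowIntegral α (Complex.exp (((1 - α) * Real.pi - Real.pi * α : ℝ) * I)
          * (Real.exp x ^ (1 - α) : ℝ))‖ ≤ 1 := by
      refine norm_expPowIntegral_le_one (re_exp_mul_I_mul_nonneg hs0 ?_)
      rw [abs_le]
      constructor <;> nlinarith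
    have h := norm_stripFun_le (x := x) (θ := Real.pi) le_rfl h3
      (hE _ _ (Real.exp_pos x).le (norm_exp_mul_I_mul hs0).le)
    have h4 : 1 ≤ Real.exp (x / 2) := Real.one_le_exp (by linarith)
    refine h.trans ?_
    rw [Real.cos_pi, mul_neg_one, mul_neg, mul_add, mul_one, ← Real.exp_half, mul_left_comm,
      ← Real.exp_add, neg_add_cancel, Real.exp_zero, mul_one]
    have h5 : Real.exp (-(saddleRate α * Real.exp x)) ≤ 1 := Real.exp_le_one_iff.2 (neg_nonpos.2
      (mul_nonneg (saddleRate_nonneg h0 h1) (Real.exp_pos x).le))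
    nlinarith

theorem one_le_norm_add_I {z : ℂ} (hz : 0 ≤ z.im) : max 1 ‖z‖ ≤ ‖z + I‖ := by
  refine max_le ?_ ?_
  · have := (le_abs_self _).trans (abs_im_le_norm (z + I))
    simp at this
    linarith
  · rw [← sq_le_sq₀ (norm_nonneg _) (norm_nonneg _), Complex.sq_norm, Complex.sq_norm, normSq_apply,
      normSq_apply]
    simp
    nlinarith

theorem exp_im_nonneg {w : ℂ} (hw0 : 0 ≤ w.im) (hw1 : w.im ≤ Real.pi) : 0 ≤ (Complex.exp w).im := by
  rw [Complex.exp_im]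
  exact mul_nonneg (Real.exp_pos _).le (Real.sin_nonneg_of_nonneg_of_le_pi hw0 hw1)

theorem norm_exp_neg_half (w : ℂ) : ‖Complex.exp (-(w / 2))‖ = Real.exp (-(w.re / 2)) := by
  rw [Complex.norm_exp, neg_re, div_ofNat_re]

/-- The growth bound of `stripFun` on the strip `0 ≤ Im w ≤ π`. -/
theorem exists_norm_stripFun_strip_le (h0 : 0 < α) (h1 : α ≤ 1 / 2) (h2 : 1 / 3 ≤ α) :
    ∃ C : ℝ, 0 ≤ C ∧ ∀ w : ℂ, 0 ≤ w.im → w.im ≤ Real.pi →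
      ‖stripFun α w‖ ≤ C * Real.exp (w.re / 2) := by
  obtain ⟨C₀, hC₀, hl₀⟩ := exists_norm_stripFun_line_zero_le h0 h1
  obtain ⟨C₁, hC₁, hl₁⟩ := exists_norm_stripFun_line_half_pi_le h0 h1
  obtain ⟨C₂, hC₂, hl₂⟩ := exists_norm_stripFun_line_pi_le h0 h1 h2
  obtain ⟨K, B, hK, hB, hap⟩ := exists_norm_stripFun_le_exp_exp h0 h1
  have hpi := Real.pi_pos
  have hdF := differentiable_stripFun h0 h1
  have hform : ∀ (w : ℂ) (θ : ℝ), w.im = θ → w = w.re + θ * I := fun w θ h => by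
    rw [← h, re_add_im]
  have hcancel : ∀ x : ℝ, Real.exp (x / 2) * Real.exp (-(x / 2)) = 1 := fun x => by
    rw [← Real.exp_add, add_neg_cancel, Real.exp_zero]
  set h : ℂ → ℂ := fun w => stripFun α w * Complex.exp (-(w / 2)) with hh
  set k : ℂ → ℂ := fun w => h w / (Complex.exp w + I) with hk
  have hhn : ∀ w, ‖h w‖ = ‖stripFun α w‖ * Real.exp (-(w.re / 2)) := fun w => by
    rw [hh, norm_mul, norm_exp_neg_half]
  have hden : ∀ w : ℂ, 0 ≤ w.im → w.im ≤ Real.pi →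
      max 1 (Real.exp w.re) ≤ ‖Complex.exp w + I‖ := fun w hw0 hw1 => by
    rw [← Complex.norm_exp]
    exact one_le_norm_add_I (exp_im_nonneg hw0 hw1)
  have hden0 : ∀ w : ℂ, 0 ≤ w.im → w.im ≤ Real.pi → Complex.exp w + I ≠ 0 := fun w hw0 hw1 =>
    norm_pos_iff.1 (one_pos.trans_le ((le_max_left _ _).trans (hden w hw0 hw1)))
  have hdh : Differentiable ℂ h := by rw [hh]; fun_prop
  have hdk : ∀ w : ℂ, 0 ≤ w.im → w.im ≤ Real.pi → DifferentiableAt ℂ k w := fun w hw0 hw1 =>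
    (hdh w).div (by fun_prop) (hden0 w hw0 hw1)
  have hkn : ∀ w : ℂ, 0 ≤ w.im → w.im ≤ Real.pi → ∀ D : ℝ, 0 ≤ D →
      ‖stripFun α w‖ ≤ D * Real.exp (w.re / 2) * max 1 (Real.exp w.re) → ‖k w‖ ≤ D := by
    intro w hw0 hw1 D hD hle
    rw [hk, norm_div, div_le_iff₀ (one_pos.trans_le ((le_max_left _ _).trans (hden w hw0 hw1))), hhn]
    calc _ ≤ D * Real.exp (w.re / 2) * max 1 (Real.exp w.re) * Real.exp (-(w.re / 2)) := by gcongr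
      _ = D * max 1 (Real.exp w.re) * (Real.exp (w.re / 2) * Real.exp (-(w.re / 2))) := by ring
      _ ≤ _ := by
        rw [hcancel, mul_one]
        exact mul_le_mul_of_nonneg_left (hden w hw0 hw1) hD
  set D := C₀ + C₁ + C₂ with hD
  have hD0 : 0 ≤ D := by positivity
  have hk0 : ∀ w : ℂ, w.im = 0 → ‖k w‖ ≤ D := fun w hw => by
    refine hkn w hw.ge (by rw [hw]; exact hpi.le) D hD0 ?_
    have h3 := hl₀ w.re
    rw [← hform w 0 hw] at h3
    refine h3.trans ?_
    have : C₀ * Real.exp (w.re / 2) ≤ D * Real.exp (w.re / 2) := by gcongr; linarith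
    exact this.trans (le_mul_of_one_le_right (by positivity) (le_max_left _ _))
  have hk1 : ∀ w : ℂ, w.im = Real.pi / 2 → ‖k w‖ ≤ D := fun w hw => by
    refine hkn w (by rw [hw]; positivity) (by rw [hw]; linarith) D hD0 ?_
    have h3 := hl₁ w.re
    rw [← hform w _ hw] at h3
    refine h3.trans ?_
    gcongr
    linarith
  have hk2 : ∀ w : ℂ, w.im = Real.pi → ‖k w‖ ≤ D := fun w hw => by
    refine hkn w (by rw [hw]; positivity) hw.le D hD0 ?_
    have h3 := hl₂ w.re
    rw [← hform w _ hw] at h3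
    refine h3.trans ?_
    have : C₂ * Real.exp (w.re / 2) ≤ D * Real.exp (w.re / 2) := by gcongr; linarith
    exact this.trans (le_mul_of_one_le_right (by positivity) (le_max_left _ _))
  have hkap : ∀ w : ℂ, 0 ≤ w.im → w.im ≤ Real.pi →
      ‖k w‖ ≤ K * Real.exp ((B + 1) * Real.exp (1 * |w.re|)) := by
    intro w hw0 hw1
    have h3 : ‖k w‖ ≤ ‖h w‖ := by
      rw [hk, norm_div]
      exact div_le_self (norm_nonneg _) ((le_max_left _ _).trans (hden w hw0 hw1))
    refine h3.trans ?_
    rw [hhn]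
    calc _ ≤ K * Real.exp (B * Real.exp |w.re|) * Real.exp (Real.exp |w.re|) := by
          gcongr
          · exact hap w
          · linarith [neg_abs_le w.re, abs_nonneg w.re, Real.add_one_le_exp |w.re|]
      _ = _ := by rw [mul_assoc, ← Real.exp_add]; ring_nf
  have hkD : ∀ w : ℂ, 0 ≤ w.im → w.im ≤ Real.pi → ‖k w‖ ≤ D := by
    intro w hw0 hw1
    rcases le_total w.im (Real.pi / 2) with hw | hw
    · refine strip_norm_le (a := 0) (b := Real.pi / 2) (c := 1) (by positivity)
        (fun w h3 h4 => hdk w h3 (by linarith)) ?_ (fun w h3 h4 => hkap w h3 (by linarith))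
        hk0 hk1 hw0 hw
      rw [sub_zero, lt_div_iff₀ (by positivity)]
      linarith
    · refine strip_norm_le (a := Real.pi / 2) (b := Real.pi) (c := 1) (by linarith)
        (fun w h3 h4 => hdk w (by linarith) h4) ?_ (fun w h3 h4 => hkap w (by linarith) h4)
        hk1 hk2 hw hw1
      rw [lt_div_iff₀ (by linarith)]
      linarith
  have hhap : ∀ w : ℂ, 0 ≤ w.im → w.im ≤ Real.pi →
      ‖h w‖ ≤ (2 * D) * Real.exp (2 * Real.exp (1 / 2 * |w.re|)) := by
    intro w hw0 hw1
    have e : h w = k w * (Complex.exp w + I) := by rw [hk, div_mul_cancel₀ _ (hden0 w hw0 hw1)]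
    rw [e, norm_mul]
    have h3 : ‖Complex.exp w + I‖ ≤ 2 * Real.exp |w.re| := by
      refine (norm_add_le _ _).trans ?_
      rw [Complex.norm_exp, norm_I]
      linarith [Real.exp_le_exp.2 (le_abs_self w.re), Real.one_le_exp (abs_nonneg w.re)]
    calc _ ≤ D * (2 * Real.exp |w.re|) := by
          gcongr
          exact hkD w hw0 hw1
      _ = 2 * D * Real.exp |w.re| := by ring
      _ ≤ _ := by
          gcongr
          linarith [Real.add_one_le_exp (1 / 2 * |w.re|)]
  refine ⟨D, hD0, fun w hw0 hw1 => ?_⟩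
  have hb : ∀ w : ℂ, ∀ E : ℝ, E ≤ D → ‖stripFun α w‖ ≤ E * Real.exp (w.re / 2) → ‖h w‖ ≤ D := by
    intro w E hE hle
    rw [hhn]
    calc _ ≤ E * Real.exp (w.re / 2) * Real.exp (-(w.re / 2)) := by gcongr
      _ = E := by rw [mul_assoc, hcancel, mul_one]
      _ ≤ D := hE
  have hfin : ‖h w‖ ≤ D := by
    refine strip_norm_le (a := 0) (b := Real.pi) (c := 1 / 2) hpi (fun w _ _ => hdh w) ?_ hhap
      (fun w hw => hb w C₀ (by linarith) ?_) (fun w hw => hb w C₂ (by linarith) ?_) hw0 hw1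
    · rw [sub_zero, div_self hpi.ne']; norm_num
    · have h3 := hl₀ w.re
      rwa [← hform w 0 hw] at h3
    · have h3 := hl₂ w.re
      rwa [← hform w _ hw] at h3
  rw [hhn] at hfin
  calc ‖stripFun α w‖ = ‖stripFun α w‖ * Real.exp (-(w.re / 2)) * Real.exp (w.re / 2) := by
        rw [mul_assoc, mul_comm (Real.exp (-(w.re / 2))), hcancel, mul_one]
    _ ≤ _ := by gcongr

end StripFun

section TopBoundary

variable {α : ℝ}

theorem re_ofReal_add_mul_I (a b : ℝ) : ((a : ℂ) + b * I).re = a := by simp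

theorem im_ofReal_add_mul_I (a b : ℝ) : ((a : ℂ) + b * I).im = b := by simp

theorem exp_pow_integrand_eq (φ s y : ℝ) :
    Complex.exp (-(-Complex.exp (φ * I) * s * (y ^ α : ℝ)) - y)
      = Complex.exp ((Real.cos φ * (s * y ^ α) - y : ℝ) + (Real.sin φ * (s * y ^ α) : ℝ) * I) := by
  congr 1
  rw [exp_mul_I, ← ofReal_cos, ← ofReal_sin]
  push_cast
  ring

theorem expPowIntegral_re (h0 : 0 < α) (h1 : α ≤ 1 / 2) (φ s : ℝ) :
    IntegrableOn (fun y : ℝ => Real.exp (Real.cos φ * (s * y ^ α) - y)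
      * Real.cos (Real.sin φ * (s * y ^ α))) (Ioi 0) ∧
    (expPowIntegral α (-Complex.exp (φ * I) * s)).re = ∫ y in Ioi (0 : ℝ),
      Real.exp (Real.cos φ * (s * y ^ α) - y) * Real.cos (Real.sin φ * (s * y ^ α)) := by
  have hi := integrableOn_expPow h0 h1 (-Complex.exp (φ * I) * s)
  have e : ∀ y : ℝ, (Complex.exp (-(-Complex.exp (φ * I) * s * (y ^ α : ℝ)) - y)).re
      = Real.exp (Real.cos φ * (s * y ^ α) - y) * Real.cos (Real.sin φ * (s * y ^ α)) := fun y => by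
    rw [exp_pow_integrand_eq, Complex.exp_re, re_ofReal_add_mul_I, im_ofReal_add_mul_I]
  refine ⟨?_, ?_⟩
  · simp only [← e]
    exact hi.re
  · simp only [← e]
    exact (integral_re hi).symm

theorem expPowIntegral_im (h0 : 0 < α) (h1 : α ≤ 1 / 2) (φ s : ℝ) :
    IntegrableOn (fun y : ℝ => Real.exp (Real.cos φ * (s * y ^ α) - y)
      * Real.sin (Real.sin φ * (s * y ^ α))) (Ioi 0) ∧
    (expPowIntegral α (-Complex.exp (φ * I) * s)).im = ∫ y in Ioi (0 : ℝ),
      Real.exp (Real.cos φ * (s * y ^ α) - y) * Real.sin (Real.sin φ * (s * y ^ α)) := by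
  have hi := integrableOn_expPow h0 h1 (-Complex.exp (φ * I) * s)
  have e : ∀ y : ℝ, (Complex.exp (-(-Complex.exp (φ * I) * s * (y ^ α : ℝ)) - y)).im
      = Real.exp (Real.cos φ * (s * y ^ α) - y) * Real.sin (Real.sin φ * (s * y ^ α)) := fun y => by
    rw [exp_pow_integrand_eq, Complex.exp_im, re_ofReal_add_mul_I, im_ofReal_add_mul_I]
  refine ⟨?_, ?_⟩
  · simp only [← e]
    exact hi.im
  · simp only [← e]
    exact (integral_im hi).symm

/-- Minus the real part of `stripFun` on the line `Im w = π`, up to a positive factor. -/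
noncomputable def topRe (α s : ℝ) : ℝ :=
  (expPowIntegral α (-Complex.exp ((2 * Real.pi * α : ℝ) * I) * s)).im

/-- The imaginary part of `stripFun` on the line `Im w = π`, up to a positive factor. -/
noncomputable def topIm (α s : ℝ) : ℝ :=
  (expPowIntegral α (-Complex.exp ((0 : ℝ) * I) * s)).re
    - (expPowIntegral α (-Complex.exp ((2 * Real.pi * α : ℝ) * I) * s)).re

/-- The function whose average is `topIm`. -/
noncomputable def topKernel (φ Y : ℝ) : ℝ :=
  Real.exp Y - Real.exp (Real.cos φ * Y) * Real.cos (Real.sin φ * Y)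

theorem topIm_eq (h0 : 0 < α) (h1 : α ≤ 1 / 2) (s : ℝ) :
    IntegrableOn (fun y : ℝ => topKernel (2 * Real.pi * α) (s * y ^ α) * Real.exp (-y)) (Ioi 0) ∧
    topIm α s = ∫ y in Ioi (0 : ℝ), topKernel (2 * Real.pi * α) (s * y ^ α) * Real.exp (-y) := by
  obtain ⟨i1, e1⟩ := expPowIntegral_re h0 h1 0 s
  obtain ⟨i2, e2⟩ := expPowIntegral_re h0 h1 (2 * Real.pi * α) s
  have e : ∀ y : ℝ, topKernel (2 * Real.pi * α) (s * y ^ α) * Real.exp (-y)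
      = Real.exp (Real.cos 0 * (s * y ^ α) - y) * Real.cos (Real.sin 0 * (s * y ^ α))
        - Real.exp (Real.cos (2 * Real.pi * α) * (s * y ^ α) - y)
          * Real.cos (Real.sin (2 * Real.pi * α) * (s * y ^ α)) := fun y => by
    rw [topKernel, sub_eq_add_neg _ y, sub_eq_add_neg _ y, Real.exp_add, Real.exp_add]
    simp
    ring
  simp only [e]
  exact ⟨i1.sub i2, by rw [topIm, e1, e2, integral_sub i1 i2]⟩

theorem topKernel_pos {φ Y : ℝ} (hφ : Real.cos φ ≤ 0) (hY : 0 < Y) : 0 < topKernel φ Y := by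
  have h1 : 1 < Real.exp Y := Real.one_lt_exp_iff.2 hY
  have h2 : Real.exp (Real.cos φ * Y) ≤ 1 := Real.exp_le_one_iff.2 (by nlinarith)
  have h3 := Real.cos_le_one (Real.sin φ * Y)
  rw [topKernel]
  nlinarith [Real.exp_pos (Real.cos φ * Y)]

theorem convexOn_topKernel {φ : ℝ} (hφ : Real.cos φ ≤ 0) : ConvexOn ℝ (Ici 0) (topKernel φ) := by
  have d1 : ∀ Y, HasDerivAt (topKernel φ) (Real.exp Y
      - Real.exp (Real.cos φ * Y) * Real.cos (Real.sin φ * Y + φ)) Y := by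
    intro Y
    have h1 := (((hasDerivAt_id Y).const_mul (Real.cos φ)).exp).mul
      (((hasDerivAt_id Y).const_mul (Real.sin φ)).cos)
    refine ((Real.hasDerivAt_exp Y).sub h1).congr_deriv ?_
    rw [Real.cos_add]
    simp
    ring
  have d2 : ∀ Y, HasDerivAt (fun Y => Real.exp Y
      - Real.exp (Real.cos φ * Y) * Real.cos (Real.sin φ * Y + φ)) (Real.exp Y
      - Real.exp (Real.cos φ * Y) * Real.cos (Real.sin φ * Y + φ + φ)) Y := by
    intro Y
    have h1 := (((hasDerivAt_id Y).const_mul (Real.cos φ)).exp).mul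
      ((((hasDerivAt_id Y).const_mul (Real.sin φ)).add_const φ).cos)
    refine ((Real.hasDerivAt_exp Y).sub h1).congr_deriv ?_
    rw [Real.cos_add (Real.sin φ * Y + φ)]
    simp
    ring
  refine convexOn_of_hasDerivWithinAt2_nonneg (convex_Ici 0)
    (fun Y _ => (d1 Y).continuousAt.continuousWithinAt) (fun Y _ => (d1 Y).hasDerivWithinAt)
    (fun Y _ => (d2 Y).hasDerivWithinAt) fun Y hY => ?_
  rw [interior_Ici] at hY
  have hY : 0 < Y := hY
  have h1 : 1 < Real.exp Y := Real.one_lt_exp_iff.2 hY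
  have h2 : Real.exp (Real.cos φ * Y) ≤ 1 := Real.exp_le_one_iff.2 (by nlinarith)
  have h3 := Real.cos_le_one (Real.sin φ * Y + φ + φ)
  nlinarith [Real.exp_pos (Real.cos φ * Y)]

theorem mul_topKernel_le {φ r Y : ℝ} (hφ : Real.cos φ ≤ 0) (hr : 1 ≤ r) (hY : 0 ≤ Y) :
    r * topKernel φ Y ≤ topKernel φ (r * Y) := by
  have hr0 : 0 < r := by linarith
  have h := (convexOn_topKernel hφ).2 (mem_Ici.2 le_rfl) (mem_Ici.2 (mul_nonneg hr0.le hY))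
    (sub_nonneg.2 (inv_le_one_of_one_le₀ hr)) (inv_nonneg.2 hr0.le) (by ring)
  have hz : topKernel φ 0 = 0 := by simp [topKernel]
  simp only [smul_eq_mul, mul_zero, zero_add, hz, inv_mul_cancel_left₀ hr0.ne'] at h
  rwa [← le_inv_mul_iff₀ hr0]

theorem cos_two_pi_mul_nonpos (h1 : α ≤ 1 / 2) (h2 : 1 / 3 ≤ α) : Real.cos (2 * Real.pi * α) ≤ 0 :=
  Real.cos_nonpos_of_pi_div_two_le_of_le (by nlinarith [Real.pi_pos]) (by nlinarith [Real.pi_pos])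

theorem topIm_pos (h0 : 0 < α) (h1 : α ≤ 1 / 2) (h2 : 1 / 3 ≤ α) {s : ℝ} (hs : 0 < s) :
    0 < topIm α s := by
  obtain ⟨i, e⟩ := topIm_eq h0 h1 s
  have hpos : ∀ y ∈ Ioi (0 : ℝ), 0 < topKernel (2 * Real.pi * α) (s * y ^ α) * Real.exp (-y) :=
    fun y hy => mul_pos (topKernel_pos (cos_two_pi_mul_nonpos h1 h2)
      (mul_pos hs (Real.rpow_pos_of_pos hy _))) (Real.exp_pos _)
  rw [e, setIntegral_pos_iff_support_of_nonneg_ae _ i]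
  · refine lt_of_lt_of_le ?_ (measure_mono fun y hy => ⟨(hpos y hy).ne', hy⟩)
    simp
  · filter_upwards [ae_restrict_mem measurableSet_Ioi] with y hy using (hpos y hy).le

theorem mul_topIm_le (h0 : 0 < α) (h1 : α ≤ 1 / 2) (h2 : 1 / 3 ≤ α) {r s : ℝ} (hr : 1 ≤ r)
    (hs : 0 ≤ s) : r * topIm α s ≤ topIm α (r * s) := by
  obtain ⟨i, e⟩ := topIm_eq h0 h1 s
  obtain ⟨i', e'⟩ := topIm_eq h0 h1 (r * s)
  rw [e, e', ← integral_const_mul]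
  refine setIntegral_mono_on (i.const_mul r) i' measurableSet_Ioi fun y hy => ?_
  have hy : 0 < y := hy
  rw [← mul_assoc, mul_assoc r s]
  exact mul_le_mul_of_nonneg_right (mul_topKernel_le (cos_two_pi_mul_nonpos h1 h2) hr (by positivity))
    (Real.exp_pos _).le

theorem sin_mul_exp_cos_mul_sin_le {p Y : ℝ} (hC : 0 ≤ Real.cos p) (hS : 0 ≤ Real.sin p)
    (hY : 0 ≤ Y) : Real.sin p * (Real.exp (Real.cos (2 * p) * Y) * Real.sin (Real.sin (2 * p) * Y))
      ≤ Real.cos p * topKernel (2 * p) Y := by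
  have hμ : 0 ≤ Real.sin (2 * p) * Y := by rw [Real.sin_two_mul]; positivity
  have h1 := Real.sin_le hμ
  have h2 := Real.cos_le_one (Real.sin (2 * p) * Y)
  have h3 := Real.add_one_le_exp (2 * Real.sin p ^ 2 * Y)
  have h4 : Real.exp Y = Real.exp (Real.cos (2 * p) * Y) * Real.exp (2 * Real.sin p ^ 2 * Y) := by
    rw [← Real.exp_add, Real.cos_two_mul, Real.cos_sq']
    ring_nf
  have h5 : Real.sin p * Real.sin (Real.sin (2 * p) * Y)
      + Real.cos p * Real.cos (Real.sin (2 * p) * Y)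
      ≤ Real.cos p * Real.exp (2 * Real.sin p ^ 2 * Y) := by
    have h6 : Real.sin p * Real.sin (Real.sin (2 * p) * Y) ≤ Real.sin p * (Real.sin (2 * p) * Y) := by
      gcongr
    have h7 : Real.cos p * Real.cos (Real.sin (2 * p) * Y) ≤ Real.cos p * 1 := by gcongr
    have h8 : Real.cos p * (2 * Real.sin p ^ 2 * Y + 1)
        ≤ Real.cos p * Real.exp (2 * Real.sin p ^ 2 * Y) := by gcongr
    rw [Real.sin_two_mul] at h6 ⊢
    rw [Real.sin_two_mul] at h7
    nlinarith
  have h9 := mul_le_mul_of_nonneg_left h5 (Real.exp_pos (Real.cos (2 * p) * Y)).le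
  rw [topKernel, h4]
  linarith

theorem sin_mul_topRe_le (h0 : 0 < α) (h1 : α ≤ 1 / 2) {s : ℝ} (hs : 0 ≤ s) :
    Real.sin (Real.pi * α) * topRe α s ≤ Real.cos (Real.pi * α) * topIm α s := by
  have hpi := Real.pi_pos
  have hC : 0 ≤ Real.cos (Real.pi * α) :=
    Real.cos_nonneg_of_neg_pi_div_two_le_of_le (by nlinarith) (by nlinarith)
  have hS : 0 ≤ Real.sin (Real.pi * α) :=
    Real.sin_nonneg_of_nonneg_of_le_pi (by nlinarith) (by nlinarith)
  obtain ⟨i, e⟩ := topIm_eq h0 h1 s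
  obtain ⟨i', e'⟩ := expPowIntegral_im h0 h1 (2 * Real.pi * α) s
  rw [topRe, e', e, ← integral_const_mul, ← integral_const_mul]
  refine setIntegral_mono_on (i'.const_mul _) (i.const_mul _) measurableSet_Ioi fun y hy => ?_
  have hy : 0 < y := hy
  have h := mul_le_mul_of_nonneg_right
    (sin_mul_exp_cos_mul_sin_le hC hS (show 0 ≤ s * y ^ α by positivity)) (Real.exp_pos (-y)).le
  rw [← mul_assoc 2 Real.pi α] at h
  rw [sub_eq_add_neg _ y, Real.exp_add]
  linarith

theorem stripFun_top (x : ℝ) : stripFun α (x + Real.pi * I)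
    = (Real.exp (-(saddleRate α * Real.exp x)) : ℝ)
      * (-(topRe α (Real.exp x ^ (1 - α)) : ℂ) + topIm α (Real.exp x ^ (1 - α)) * I) := by
  set s := Real.exp x ^ (1 - α) with hs
  have e1 : Complex.exp (((1 - α) * Real.pi - Real.pi * α : ℝ) * I)
      = -Complex.exp (-((2 * Real.pi * α : ℝ) * I)) := by
    rw [neg_eq_neg_one_mul, ← exp_pi_mul_I, ← Complex.exp_add]
    push_cast
    ring_nf
  have e2 : Complex.exp (((1 - α) * Real.pi + Real.pi * α : ℝ) * I) = -Complex.exp ((0 : ℝ) * I) := by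
    have : (1 - α) * Real.pi + Real.pi * α = Real.pi := by ring
    rw [this, exp_pi_mul_I]
    simp
  have e3 : expPowIntegral α (-Complex.exp (-((2 * Real.pi * α : ℝ) * I)) * s)
      = starRingEnd ℂ (expPowIntegral α (-Complex.exp ((2 * Real.pi * α : ℝ) * I) * s)) := by
    rw [← expPowIntegral_conj, map_mul, map_neg, ← Complex.exp_conj, map_mul, conj_ofReal, conj_ofReal,
      conj_I, mul_neg]
  have e4 : expPowIntegral α (-Complex.exp ((0 : ℝ) * I) * s)
      = ((expPowIntegral α (-Complex.exp ((0 : ℝ) * I) * s)).re : ℂ) := by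
    refine (conj_eq_iff_re.1 ?_).symm
    rw [← expPowIntegral_conj]
    simp
  have e5 : Complex.exp (saddleRate α * Complex.exp (x + Real.pi * I))
      = (Real.exp (-(saddleRate α * Real.exp x)) : ℝ) := by
    rw [Complex.exp_add, exp_pi_mul_I]
    push_cast
    ring_nf
  rw [stripFun_ofReal_add, e1, e2, e3, e4, e5, topRe, topIm]
  generalize Real.exp (-(saddleRate α * Real.exp x)) = a
  generalize expPowIntegral α (-Complex.exp ((2 * Real.pi * α : ℝ) * I) * s) = b
  generalize (expPowIntegral α (-Complex.exp ((0 : ℝ) * I) * s)).re = c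
  apply Complex.ext
  · simp
  · simp
    ring

end TopBoundary

section Sign

variable {α : ℝ}

theorem stripFun_ofReal_im (x : ℝ) : (stripFun α x).im = 0 := by
  rw [stripFun_ofReal, ofReal_im]

theorem eq_ofReal_of_im_eq_zero {w : ℂ} (hw : w.im = 0) : w = w.re := by
  apply Complex.ext <;> simp [hw]

theorem eq_ofReal_add_of_im_eq {w : ℂ} {b : ℝ} (hw : w.im = b) : w = w.re + b * I := by
  rw [← hw, re_add_im]

theorem half_lt_pi_div : (1 / 2 : ℝ) < Real.pi / (Real.pi - 0) := by
  rw [sub_zero, div_self Real.pi_pos.ne']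
  norm_num

theorem exists_norm_stripFun_le_abs (h0 : 0 < α) (h1 : α ≤ 1 / 2) (h2 : 1 / 3 ≤ α) :
    ∃ C : ℝ, 0 ≤ C ∧ ∀ w : ℂ, 0 ≤ w.im → w.im ≤ Real.pi →
      ‖stripFun α w‖ ≤ C * Real.exp (1 / 2 * |w.re|) := by
  obtain ⟨C, hC, hF⟩ := exists_norm_stripFun_strip_le h0 h1 h2
  refine ⟨C, hC, fun w hw0 hw1 => (hF w hw0 hw1).trans ?_⟩
  have := le_abs_self w.re
  gcongr
  linarith

theorem stripFun_top_im_pos (h0 : 0 < α) (h1 : α ≤ 1 / 2) (h2 : 1 / 3 ≤ α) (x : ℝ) :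
    0 < (stripFun α (x + Real.pi * I)).im := by
  rw [stripFun_top, im_ofReal_mul, ← ofReal_neg, im_ofReal_add_mul_I]
  exact mul_pos (Real.exp_pos _) (topIm_pos h0 h1 h2 (by positivity))

theorem stripFun_im_nonneg (h0 : 0 < α) (h1 : α ≤ 1 / 2) (h2 : 1 / 3 ≤ α) {w : ℂ}
    (hw0 : 0 ≤ w.im) (hw1 : w.im ≤ Real.pi) : 0 ≤ (stripFun α w).im := by
  obtain ⟨C, hC, hF⟩ := exists_norm_stripFun_le_abs h0 h1 h2
  refine strip_im_nonneg Real.pi_pos (fun w _ _ => differentiable_stripFun h0 h1 w)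
    half_lt_pi_div hF (fun w hw => ?_) (fun w hw => ?_) hw0 hw1
  · rw [eq_ofReal_of_im_eq_zero hw, stripFun_ofReal_im]
  · rw [eq_ofReal_add_of_im_eq hw]
    exact (stripFun_top_im_pos h0 h1 h2 _).le

theorem monotone_stripFun (h0 : 0 < α) (h1 : α ≤ 1 / 2) (h2 : 1 / 3 ≤ α) :
    Monotone fun x : ℝ => (stripFun α x).re :=
  monotone_re_of_im_nonneg Real.pi_pos (fun x => differentiable_stripFun h0 h1 x)
    stripFun_ofReal_im fun _ => stripFun_im_nonneg h0 h1 h2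

theorem stripFun_ofReal_nonneg (h0 : 0 < α) (h1 : α ≤ 1 / 2) (h2 : 1 / 3 ≤ α) (x : ℝ) :
    0 ≤ (stripFun α x).re := by
  obtain ⟨C, hC, hF⟩ := exists_norm_stripFun_strip_le h0 h1 h2
  have hlim : Tendsto (fun y : ℝ => -(C * Real.exp (y / 2))) atBot (nhds 0) := by
    have h : Tendsto (fun y : ℝ => Real.exp (y / 2)) atBot (nhds 0) :=
      Real.tendsto_exp_atBot.comp (tendsto_id.atBot_div_const two_pos)
    simpa using (h.const_mul C).neg
  refine le_of_tendsto hlim ?_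
  filter_upwards [Iic_mem_atBot x] with y hy
  refine le_trans ?_ (monotone_stripFun h0 h1 h2 hy)
  have h := hF y (by simp) (by simp [Real.pi_pos.le])
  rw [ofReal_re] at h
  linarith [(abs_le.1 ((abs_re_le_norm (stripFun α y)).trans h)).1]

theorem stripFun_ofReal_pos (h0 : 0 < α) (h1 : α ≤ 1 / 2) (h2 : 1 / 3 ≤ α) (x : ℝ) :
    0 < (stripFun α x).re := by
  refine (stripFun_ofReal_nonneg h0 h1 h2 x).lt_of_ne fun h => ?_
  have hz : ∀ y : ℝ, y ≤ x → stripFun α y = 0 := fun y hy => by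
    have hy0 : (stripFun α y).re = 0 :=
      le_antisymm ((monotone_stripFun h0 h1 h2 hy).trans h.ge) (stripFun_ofReal_nonneg h0 h1 h2 y)
    exact Complex.ext hy0 (stripFun_ofReal_im y)
  have han : AnalyticOnNhd ℂ (stripFun α) univ := fun w _ => (differentiable_stripFun h0 h1).analyticAt w
  have hfreq : ∃ᶠ w in nhdsWithin (x : ℂ) {(x : ℂ)}ᶜ, stripFun α w = 0 := by
    have ht : Tendsto (fun y : ℝ => (y : ℂ)) (nhdsWithin x (Iio x)) (nhdsWithin (x : ℂ) {(x : ℂ)}ᶜ) := by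
      refine tendsto_nhdsWithin_iff.2 ⟨(continuous_ofReal.tendsto x).mono_left nhdsWithin_le_nhds, ?_⟩
      filter_upwards [self_mem_nhdsWithin] with y hy
      simpa using (ne_of_lt hy)
    refine ht.frequently (Eventually.frequently ?_)
    filter_upwards [self_mem_nhdsWithin] with y hy using hz y (le_of_lt hy)
  have h3 := han.eqOn_zero_of_preconnected_of_frequently_eq_zero isPreconnected_univ (mem_univ _) hfreq
    (mem_univ ((0 : ℝ) + Real.pi * I : ℂ))
  have h4 := stripFun_top_im_pos h0 h1 h2 0
  rw [h3] at h4
  simp at h4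

theorem im_exp_mul_I_mul (p : ℝ) (z : ℂ) :
    (Complex.exp (p * I) * z).im = Real.sin p * z.re + Real.cos p * z.im := by
  rw [mul_im, exp_ofReal_mul_I_re, exp_ofReal_mul_I_im]
  ring

theorem im_exp_mul_stripFun_top_nonneg (h0 : 0 < α) (h1 : α ≤ 1 / 2) (x : ℝ) :
    0 ≤ (Complex.exp ((Real.pi * α : ℝ) * I) * stripFun α (x + Real.pi * I)).im := by
  rw [im_exp_mul_I_mul, stripFun_top, im_ofReal_mul, re_ofReal_mul, ← ofReal_neg,
    im_ofReal_add_mul_I, re_ofReal_add_mul_I]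
  have h := sin_mul_topRe_le h0 h1 (s := Real.exp x ^ (1 - α)) (by positivity)
  have he := Real.exp_pos (-(saddleRate α * Real.exp x))
  nlinarith

theorem sin_pi_mul_pos (h0 : 0 < α) (h1 : α ≤ 1 / 2) : 0 < Real.sin (Real.pi * α) :=
  Real.sin_pos_of_pos_of_lt_pi (mul_pos Real.pi_pos h0) (by nlinarith [Real.pi_pos])

theorem im_exp_mul_stripFun_nonneg (h0 : 0 < α) (h1 : α ≤ 1 / 2) (h2 : 1 / 3 ≤ α) {w : ℂ}
    (hw0 : 0 ≤ w.im) (hw1 : w.im ≤ Real.pi) :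
    0 ≤ (Complex.exp ((Real.pi * α : ℝ) * I) * stripFun α w).im := by
  obtain ⟨C, hC, hF⟩ := exists_norm_stripFun_le_abs h0 h1 h2
  refine strip_im_nonneg (f := fun w => Complex.exp ((Real.pi * α : ℝ) * I) * stripFun α w) Real.pi_pos
    (fun w _ _ => (differentiable_stripFun h0 h1 w).const_mul _) half_lt_pi_div (K := C)
    (fun w hwa hwb => ?_) (fun w hw => ?_) (fun w hw => ?_) hw0 hw1
  · rw [norm_mul, norm_exp_ofReal_mul_I, one_mul]
    exact hF w hwa hwb
  · rw [eq_ofReal_of_im_eq_zero hw, im_exp_mul_I_mul, stripFun_ofReal_im, mul_zero, add_zero]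
    exact mul_nonneg (sin_pi_mul_pos h0 h1).le (stripFun_ofReal_nonneg h0 h1 h2 _)
  · rw [eq_ofReal_add_of_im_eq hw]
    exact im_exp_mul_stripFun_top_nonneg h0 h1 _

theorem antitone_stripFun_mul_exp (h0 : 0 < α) (h1 : α ≤ 1 / 2) (h2 : 1 / 3 ≤ α) :
    Antitone fun x : ℝ => (stripFun α x).re * Real.exp (-((1 - α) * x)) := by
  obtain ⟨C, hC, hF⟩ := exists_norm_stripFun_strip_le h0 h1 h2
  set T : ℂ → ℂ := fun w => -(stripFun α w * Complex.exp (-((1 - α) * w))) with hT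
  have hd : Differentiable ℂ T := by
    have := differentiable_stripFun h0 h1
    fun_prop
  have hreal : ∀ x : ℝ, T x
      = ((-((stripFun α x).re * Real.exp (-((1 - α) * x))) : ℝ) : ℂ) := fun x => by
    have : stripFun α x = (stripFun α x).re := eq_ofReal_of_im_eq_zero (stripFun_ofReal_im x)
    simp only [hT]
    rw [this]
    push_cast
    rw [ofReal_re]
  have hnn : ∀ w : ℂ, 0 ≤ w.im → w.im ≤ Real.pi → 0 ≤ (T w).im := by
    intro w hw0 hw1
    refine strip_im_nonneg Real.pi_pos (fun w _ _ => hd w) half_lt_pi_div (K := C)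
      (fun w hwa hwb => ?_) (fun w hw => ?_) (fun w hw => ?_) hw0 hw1
    · have hre : (-((1 - (α : ℂ)) * w)).re = -((1 - α) * w.re) := by
        simp
      rw [hT, norm_neg, norm_mul, Complex.norm_exp, hre]
      calc ‖stripFun α w‖ * Real.exp (-((1 - α) * w.re))
          ≤ C * Real.exp (w.re / 2) * Real.exp (-((1 - α) * w.re)) := by
            gcongr
            exact hF w hwa hwb
        _ = C * Real.exp ((α - 1 / 2) * w.re) := by
            rw [mul_assoc, ← Real.exp_add]
            ring_nf
        _ ≤ C * Real.exp (1 / 2 * |w.re|) := by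
            refine mul_le_mul_of_nonneg_left (Real.exp_le_exp.2 ?_) hC
            have h3 := neg_le_abs w.re
            have h4 := le_abs_self w.re
            nlinarith
    · rw [eq_ofReal_of_im_eq_zero hw, hreal, ofReal_im]
    · rw [eq_ofReal_add_of_im_eq hw]
      generalize w.re = x
      have e : T (x + Real.pi * I) = (Real.exp (-((1 - α) * x)) : ℝ)
          * (Complex.exp ((Real.pi * α : ℝ) * I) * stripFun α (x + Real.pi * I)) := by
        have e1 : Complex.exp (-((1 - α) * (x + Real.pi * I)))
            = -((Real.exp (-((1 - α) * x)) : ℝ) * Complex.exp ((Real.pi * α : ℝ) * I)) := by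
          rw [ofReal_exp, ← Complex.exp_add, neg_eq_neg_one_mul (Complex.exp _), ← exp_pi_mul_I,
            ← Complex.exp_add, Complex.exp_eq_exp_iff_exists_int]
          refine ⟨-1, ?_⟩
          push_cast
          ring
        simp only [hT]
        rw [e1]
        ring
      rw [e, im_ofReal_mul]
      exact mul_nonneg (Real.exp_pos _).le (im_exp_mul_stripFun_top_nonneg h0 h1 x)
  have hmono := monotone_re_of_im_nonneg Real.pi_pos (fun x => hd x)
    (fun x => by rw [hreal, ofReal_im]) hnn
  intro x y hxy
  have := hmono hxy
  simp only [hreal, ofReal_re] at this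
  linarith

/-- The imaginary part of the exponential-power integral along the ray of argument `-πα`. -/
noncomputable def bottomIm (α s : ℝ) : ℝ :=
  (expPowIntegral α (Complex.exp (-(Real.pi * α : ℝ) * I) * s)).im

theorem stripFun_ofReal_re (x : ℝ) : (stripFun α x).re
    = 2 * Real.exp (saddleRate α * Real.exp x) * bottomIm α (Real.exp x ^ (1 - α)) := by
  have e : expPowIntegral α (Complex.exp (-(Real.pi * α : ℝ) * I) * (Real.exp x ^ (1 - α) : ℝ))
      = starRingEnd ℂ (expPowIntegral α (Complex.exp (Real.pi * α * I)
        * (Real.exp x ^ (1 - α) : ℝ))) := by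
    rw [← expPowIntegral_conj, map_mul, ← Complex.exp_conj]
    simp
  rw [stripFun_ofReal, ofReal_re, bottomIm, e, conj_im]
  ring

theorem exists_exp_rpow_eq (h1 : α ≤ 1 / 2) {s : ℝ} (hs : 0 < s) :
    ∃ x, Real.exp x ^ (1 - α) = s := by
  refine ⟨Real.log s / (1 - α), ?_⟩
  rw [← Real.exp_mul, div_mul_cancel₀ _ (by linarith), Real.exp_log hs]

theorem bottomIm_pos (h0 : 0 < α) (h1 : α ≤ 1 / 2) (h2 : 1 / 3 ≤ α) {s : ℝ} (hs : 0 < s) :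
    0 < bottomIm α s := by
  obtain ⟨x, rfl⟩ := exists_exp_rpow_eq h1 hs
  have h := stripFun_ofReal_pos h0 h1 h2 x
  rw [stripFun_ofReal_re] at h
  exact pos_of_mul_pos_right h (by positivity)

theorem bottomIm_mul_le (h0 : 0 < α) (h1 : α ≤ 1 / 2) (h2 : 1 / 3 ≤ α) {r s : ℝ} (hr : 1 ≤ r)
    (hs : 0 < s) : bottomIm α (r * s) ≤ r * bottomIm α s := by
  have hr0 : 0 < r := by linarith
  have hrs : 0 < r * s := by positivity
  have hle : s ≤ r * s := by nlinarith
  obtain ⟨x, hx⟩ := exists_exp_rpow_eq h1 hs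
  obtain ⟨y, hy⟩ := exists_exp_rpow_eq h1 hrs
  have hxy : x ≤ y := by
    by_contra! h
    have : Real.exp y ^ (1 - α) < Real.exp x ^ (1 - α) :=
      Real.rpow_lt_rpow (Real.exp_pos y).le (Real.exp_lt_exp.2 h) (by linarith)
    linarith
  have ha := antitone_stripFun_mul_exp h0 h1 h2 hxy
  simp only [stripFun_ofReal_re, hx, hy] at ha
  have ex : Real.exp (-((1 - α) * x)) = s⁻¹ := by
    rw [← hx, ← Real.exp_mul, Real.exp_neg, mul_comm]
  have ey : Real.exp (-((1 - α) * y)) = (r * s)⁻¹ := by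
    rw [← hy, ← Real.exp_mul, Real.exp_neg, mul_comm]
  rw [ex, ey] at ha
  have hE : Real.exp (saddleRate α * Real.exp x) ≤ Real.exp (saddleRate α * Real.exp y) := by
    have := saddleRate_nonneg h0 h1
    gcongr
  have hb := bottomIm_pos h0 h1 h2 hrs
  have hX := Real.exp_pos (saddleRate α * Real.exp x)
  have h3 : 2 * Real.exp (saddleRate α * Real.exp x) * bottomIm α (r * s) * (r * s)⁻¹
      ≤ 2 * Real.exp (saddleRate α * Real.exp x) * bottomIm α s * s⁻¹ :=
    le_trans (by gcongr) ha
  have h4 : (2 * Real.exp (saddleRate α * Real.exp x) * s⁻¹ * r⁻¹) * bottomIm α (r * s)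
      ≤ (2 * Real.exp (saddleRate α * Real.exp x) * s⁻¹ * r⁻¹) * (r * bottomIm α s) := by
    calc _ = 2 * Real.exp (saddleRate α * Real.exp x) * bottomIm α (r * s) * (r * s)⁻¹ := by
          rw [mul_inv]; ring
      _ ≤ _ := h3
      _ = _ := by field_simp
  exact le_of_mul_le_mul_left h4 (by positivity)

theorem expPowIntegral_ofReal_im (s : ℝ) : (expPowIntegral α s).im = 0 := by
  rw [← conj_eq_iff_im, ← expPowIntegral_conj, conj_ofReal]

/-- If the imaginary part of `m E(κ) + n E(r κ)` is nonnegative for `κ` on the ray of argument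
`-πα`, then it is nonnegative in the sector between that ray and the positive half-line. -/
theorem im_expPowIntegral_sector_nonneg (h0 : 0 < α) (h1 : α ≤ 1 / 2) {m n r : ℝ} (hr : 0 ≤ r)
    (hray : ∀ s : ℝ, 0 < s → 0 ≤ m * bottomIm α s + n * bottomIm α (r * s)) {t s : ℝ}
    (ht : 0 ≤ t) (htα : t ≤ Real.pi * α) (hs : 0 < s) :
    0 ≤ m * (expPowIntegral α (Complex.exp (-(t : ℝ) * I) * s)).im
      + n * (expPowIntegral α (Complex.exp (-(t : ℝ) * I) * (r * s : ℝ))).im := by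
  have hpi := Real.pi_pos
  have hp : 0 < Real.pi * α := by positivity
  have hd := differentiable_expPowIntegral h0 h1
  have key : ∀ (x θ : ℝ), ((m : ℂ) * expPowIntegral α (Complex.exp (x + θ * I))
        + n * expPowIntegral α (r * Complex.exp (x + θ * I))).im
      = m * (expPowIntegral α (Complex.exp (θ * I) * Real.exp x)).im
        + n * (expPowIntegral α (Complex.exp (θ * I) * (r * Real.exp x : ℝ))).im := fun x θ => by
    have e1 : Complex.exp (x + θ * I) = Complex.exp (θ * I) * Real.exp x := by
      rw [add_comm, Complex.exp_add, ofReal_exp]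
    have e2 : (r : ℂ) * (Complex.exp (θ * I) * Real.exp x)
        = Complex.exp (θ * I) * (r * Real.exp x : ℝ) := by
      push_cast
      ring
    rw [add_im, im_ofReal_mul, im_ofReal_mul, e1, e2]
  have h := strip_im_nonneg (a := -(Real.pi * α)) (b := 0) (c := 0) (K := |m| + |n|)
    (f := fun w => (m : ℂ) * expPowIntegral α (Complex.exp w)
      + n * expPowIntegral α (r * Complex.exp w))
    (w := Real.log s + (-t : ℝ) * I) (by linarith) (fun w _ _ => by fun_prop)
    (by rw [zero_sub, neg_neg]; positivity) (fun w hwa hwb => ?_) (fun w hw => ?_) (fun w hw => ?_)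
    (by rw [im_ofReal_add_mul_I]; linarith) (by rw [im_ofReal_add_mul_I]; linarith)
  · rw [key, Real.exp_log hs, ofReal_neg] at h
    exact h
  · have hre : 0 ≤ (Complex.exp w).re := by
      rw [Complex.exp_re]
      exact mul_nonneg (Real.exp_pos _).le
        (Real.cos_nonneg_of_neg_pi_div_two_le_of_le (by nlinarith) (by linarith))
    have hre' : 0 ≤ ((r : ℂ) * Complex.exp w).re := by
      rw [re_ofReal_mul]
      exact mul_nonneg hr hre
    rw [zero_mul, Real.exp_zero, mul_one]
    refine (norm_add_le _ _).trans ?_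
    rw [norm_mul, norm_mul, norm_real, norm_real, Real.norm_eq_abs, Real.norm_eq_abs]
    exact add_le_add (mul_le_of_le_one_right (abs_nonneg m) (norm_expPowIntegral_le_one hre))
      (mul_le_of_le_one_right (abs_nonneg n) (norm_expPowIntegral_le_one hre'))
  · rw [eq_ofReal_add_of_im_eq hw, key]
    have := hray (Real.exp w.re) (Real.exp_pos _)
    simpa only [bottomIm, ofReal_neg] using this
  · rw [eq_ofReal_add_of_im_eq hw, key, ofReal_zero, zero_mul, Complex.exp_zero, one_mul, one_mul,
      expPowIntegral_ofReal_im, expPowIntegral_ofReal_im]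
    simp

theorem topRe_eq (s : ℝ) : topRe α s
    = (expPowIntegral α (Complex.exp (-(Real.pi * (1 - 2 * α) : ℝ) * I) * s)).im := by
  have e : Complex.exp (-(Real.pi * (1 - 2 * α) : ℝ) * I)
      = -Complex.exp ((2 * Real.pi * α : ℝ) * I) := by
    rw [neg_eq_neg_one_mul (Complex.exp _), ← exp_pi_mul_I, ← Complex.exp_add,
      Complex.exp_eq_exp_iff_exists_int]
    refine ⟨-1, ?_⟩
    push_cast
    ring
  rw [topRe, e]

theorem topRe_nonneg (h0 : 0 < α) (h1 : α ≤ 1 / 2) (h2 : 1 / 3 ≤ α) {s : ℝ} (hs : 0 < s) :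
    0 ≤ topRe α s := by
  have hpi := Real.pi_pos
  have h := im_expPowIntegral_sector_nonneg (m := 1) (n := 0) (r := 0) h0 h1 le_rfl
    (fun s hs => by simpa using (bottomIm_pos h0 h1 h2 hs).le)
    (t := Real.pi * (1 - 2 * α)) (by nlinarith) (by nlinarith) hs
  rw [topRe_eq]
  linarith

theorem topRe_mul_le (h0 : 0 < α) (h1 : α ≤ 1 / 2) (h2 : 1 / 3 ≤ α) {r s : ℝ} (hr : 1 ≤ r)
    (hs : 0 < s) : topRe α (r * s) ≤ r * topRe α s := by
  have hpi := Real.pi_pos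
  have h := im_expPowIntegral_sector_nonneg (m := r) (n := -1) (r := r) h0 h1 (by linarith)
    (fun s hs => by linarith [bottomIm_mul_le h0 h1 h2 hr hs])
    (t := Real.pi * (1 - 2 * α)) (by nlinarith) (by nlinarith) hs
  rw [topRe_eq, topRe_eq]
  linarith

theorem topRe_mul_topIm_le (h0 : 0 < α) (h1 : α ≤ 1 / 2) (h2 : 1 / 3 ≤ α) {s s' : ℝ} (hs : 0 < s)
    (hss' : s ≤ s') : topRe α s' * topIm α s ≤ topRe α s * topIm α s' := by
  obtain ⟨r, hr, rfl⟩ : ∃ r, 1 ≤ r ∧ s' = r * s :=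
    ⟨s' / s, (one_le_div hs).2 hss', by field_simp⟩
  calc topRe α (r * s) * topIm α s ≤ r * topRe α s * topIm α s :=
        mul_le_mul_of_nonneg_right (topRe_mul_le h0 h1 h2 hr hs) (topIm_pos h0 h1 h2 hs).le
    _ = topRe α s * (r * topIm α s) := by ring
    _ ≤ _ := mul_le_mul_of_nonneg_left (mul_topIm_le h0 h1 h2 hr hs.le) (topRe_nonneg h0 h1 h2 hs)

/-- In the open upper half plane, arguments are compared by a determinant. -/
theorem arg_le_arg_of_det_nonneg {z w : ℂ} (hz : 0 < z.im) (hw : 0 < w.im)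
    (h : 0 ≤ z.re * w.im - z.im * w.re) : z.arg ≤ w.arg := by
  by_contra! hlt
  have hz1 : 0 < ‖z‖ := norm_pos_iff.2 (by rintro rfl; simp at hz)
  have hw1 : 0 < ‖w‖ := norm_pos_iff.2 (by rintro rfl; simp at hw)
  have hsin : 0 < Real.sin (z.arg - w.arg) :=
    Real.sin_pos_of_pos_of_lt_pi (by linarith)
      (by linarith [arg_le_pi z, arg_nonneg_iff.2 hw.le, (arg_lt_pi_iff (z := z)).2 (Or.inr hz.ne')])
  rw [Real.sin_sub] at hsin
  rw [← norm_mul_cos_arg z, ← norm_mul_sin_arg z, ← norm_mul_cos_arg w, ← norm_mul_sin_arg w] at h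
  nlinarith [mul_pos hz1 hw1, mul_pos (mul_pos hz1 hw1) hsin]

theorem antitone_arg_stripFun_top (h0 : 0 < α) (h1 : α ≤ 1 / 2) (h2 : 1 / 3 ≤ α) :
    Antitone fun x : ℝ => (stripFun α (x + Real.pi * I)).arg := by
  intro x y hxy
  refine arg_le_arg_of_det_nonneg (stripFun_top_im_pos h0 h1 h2 y) (stripFun_top_im_pos h0 h1 h2 x) ?_
  have hs : 0 < Real.exp x ^ (1 - α) := by positivity
  have hle : Real.exp x ^ (1 - α) ≤ Real.exp y ^ (1 - α) :=
    Real.rpow_le_rpow (Real.exp_pos x).le (Real.exp_le_exp.2 hxy) (by linarith)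
  have h := topRe_mul_topIm_le h0 h1 h2 hs hle
  simp only [stripFun_top, im_ofReal_mul, re_ofReal_mul, ← ofReal_neg,
    im_ofReal_add_mul_I, re_ofReal_add_mul_I]
  have hx := Real.exp_pos (-(saddleRate α * Real.exp x))
  have hy := Real.exp_pos (-(saddleRate α * Real.exp y))
  nlinarith [mul_pos hx hy, mul_nonneg (mul_pos hx hy).le (sub_nonneg.2 h)]

end Sign

section Representation

variable {α : ℝ}

theorem stripFun_add_bounds (h0 : 0 < α) (h1 : α ≤ 1 / 2) (h2 : 1 / 3 ≤ α) {ε : ℝ} (hε : 0 < ε)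
    {w : ℂ} (hw : |w.im| ≤ Real.pi) : stripFun α w + ε ∈ slitPlane ∧
      ε * Real.sin (Real.pi * α) ≤ ‖stripFun α w + ε‖ := by
  have hS := sin_pi_mul_pos h0 h1
  have upper : ∀ w : ℂ, 0 ≤ w.im → w.im ≤ Real.pi → stripFun α w + ε ∈ slitPlane ∧
      ε * Real.sin (Real.pi * α) ≤ ‖stripFun α w + ε‖ := by
    intro w hw0 hw1
    have him := stripFun_im_nonneg h0 h1 h2 hw0 hw1
    have hrot := im_exp_mul_stripFun_nonneg h0 h1 h2 hw0 hw1
    rw [im_exp_mul_I_mul] at hrot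
    refine ⟨?_, ?_⟩
    · rw [mem_slitPlane_iff, add_re, add_im, ofReal_re, ofReal_im, add_zero]
      rcases him.eq_or_lt with h | h
      · rw [← h, mul_zero, add_zero] at hrot
        have := nonneg_of_mul_nonneg_right hrot hS
        exact Or.inl (by linarith)
      · exact Or.inr h.ne'
    · have h := (le_abs_self _).trans
        (abs_im_le_norm (Complex.exp ((Real.pi * α : ℝ) * I) * (stripFun α w + ε)))
      rw [norm_mul, norm_exp_ofReal_mul_I, one_mul, im_exp_mul_I_mul, add_re, add_im, ofReal_re,
        ofReal_im] at h
      linarith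
  rcases le_total 0 w.im with h | h
  · exact upper w h (abs_le.1 hw).2
  · have e : stripFun α w + ε = starRingEnd ℂ (stripFun α (starRingEnd ℂ w) + ε) := by
      rw [stripFun_conj, map_add, conj_conj, conj_ofReal]
    obtain ⟨h3, h4⟩ := upper (starRingEnd ℂ w) (by simpa using h)
      (by rw [conj_im]; linarith [(abs_le.1 hw).1])
    rw [e, norm_conj]
    refine ⟨?_, h4⟩
    rw [mem_slitPlane_iff] at h3 ⊢
    simpa using h3

theorem exists_norm_stripFun_le_abs_strip (h0 : 0 < α) (h1 : α ≤ 1 / 2) (h2 : 1 / 3 ≤ α) :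
    ∃ C : ℝ, 0 ≤ C ∧ ∀ w : ℂ, |w.im| ≤ Real.pi → ‖stripFun α w‖ ≤ C * Real.exp (1 / 2 * |w.re|) := by
  obtain ⟨C, hC, hF⟩ := exists_norm_stripFun_le_abs h0 h1 h2
  refine ⟨C, hC, fun w hw => ?_⟩
  rcases le_total 0 w.im with h | h
  · exact hF w h (abs_le.1 hw).2
  · have := hF (starRingEnd ℂ w) (by simpa using h) (by rw [conj_im]; linarith [(abs_le.1 hw).1])
    rwa [stripFun_conj, norm_conj, conj_re] at this

theorem norm_log_le_of_bounds {z : ℂ} {δ K t : ℝ} (hδ : 0 < δ) (hK : 0 < K) (ht : 0 ≤ t)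
    (h : δ ≤ ‖z‖) (h' : ‖z‖ ≤ K * Real.exp t) :
    ‖Complex.log z‖ ≤ |Real.log δ| + |Real.log K| + Real.pi + t := by
  have hz : 0 < ‖z‖ := hδ.trans_le h
  have hl := Real.log_le_log hδ h
  have hu := Real.log_le_log hz h'
  rw [Real.log_mul hK.ne' (Real.exp_pos t).ne', Real.log_exp] at hu
  have habs : |Real.log ‖z‖| ≤ |Real.log δ| + |Real.log K| + t := by
    rw [abs_le]
    constructor <;> linarith [neg_abs_le (Real.log δ), le_abs_self (Real.log K),
      abs_nonneg (Real.log K), abs_nonneg (Real.log δ)]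
  have := norm_le_abs_re_add_abs_im (Complex.log z)
  rw [log_re, log_im] at this
  linarith [abs_arg_le_pi z]

theorem stripFun_add_representation (h0 : 0 < α) (h1 : α ≤ 1 / 2) (h2 : 1 / 3 ≤ α) {ε : ℝ}
    (hε : 0 < ε) (x : ℝ) :
    Real.log ((stripFun α x).re + ε) - x - Real.log ((stripFun α (0 : ℝ)).re + ε)
      = ∫ τ : ℝ, (1 - (stripFun α (τ + Real.pi * I) + ε).arg / Real.pi)
        * (logisticKernel (Real.exp x) τ - logisticKernel 1 τ) := by
  have hpi := Real.pi_pos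
  obtain ⟨C, hC, hF⟩ := exists_norm_stripFun_le_abs_strip h0 h1 h2
  have hb := fun {w : ℂ} => stripFun_add_bounds h0 h1 h2 hε (w := w)
  have hδ : 0 < ε * Real.sin (Real.pi * α) := mul_pos hε (sin_pi_mul_pos h0 h1)
  have hre : ∀ y : ℝ, (Complex.log (stripFun α y + ε) - y).re
      = Real.log ((stripFun α y).re + ε) - y := fun y => by
    have e : stripFun α y + ε = (((stripFun α y).re + ε : ℝ) : ℂ) := by
      rw [ofReal_add, ← eq_ofReal_of_im_eq_zero (stripFun_ofReal_im y)]
    rw [e, sub_re, log_ofReal_re, ofReal_re]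
  have him : ∀ τ : ℝ, (Complex.log (stripFun α (τ + Real.pi * I) + ε) - (τ + Real.pi * I)).im
      = (stripFun α (τ + Real.pi * I) + ε).arg - Real.pi := fun τ => by
    rw [sub_im, log_im, im_ofReal_add_mul_I]
  have h := strip_representation (M := fun w => Complex.log (stripFun α w + ε) - w)
    (A := |Real.log (ε * Real.sin (Real.pi * α))| + |Real.log (C + ε)| + Real.pi + Real.pi)
    (B := 3 / 2) (b := Real.pi) (fun w hw => ?_) (fun w hw => ?_) (fun w hw => ?_) (fun τ => ?_) x
  · have h3 := hre 0
    rw [ofReal_zero] at h3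
    rw [hre, h3] at h
    simp only [him] at h
    rw [ofReal_zero]
    refine Eq.trans (by ring) (h.trans (integral_congr_ae (ae_of_all _ fun τ => ?_)))
    field_simp
    ring
  · exact (((differentiable_stripFun h0 h1 w).add_const _).clog (hb hw).1).sub differentiableAt_id
  · rw [map_sub, stripFun_conj, ← log_conj _ (slitPlane_arg_ne_pi (hb hw).1), map_add, conj_ofReal]
  · have hlog := norm_log_le_of_bounds (t := 1 / 2 * |w.re|) hδ (show 0 < C + ε by positivity)
      (by positivity) (hb hw).2 (by
        refine (norm_add_le _ _).trans ?_
        rw [norm_real, Real.norm_eq_abs, abs_of_pos hε, add_mul]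
        exact add_le_add (hF w hw) (le_mul_of_one_le_right hε.le (Real.one_le_exp (by positivity))))
    have := norm_le_abs_re_add_abs_im w
    refine (norm_sub_le _ _).trans ?_
    linarith
  · rw [him, abs_le]
    have h3 : 0 ≤ (stripFun α (τ + Real.pi * I) + ε).arg := by
      rw [arg_nonneg_iff, add_im, ofReal_im, add_zero]
      exact (stripFun_top_im_pos h0 h1 h2 τ).le
    constructor <;> linarith [arg_le_pi (stripFun α (τ + Real.pi * I) + ε)]

/-- The increasing function representing `stripFun` through its boundary argument. -/
noncomputable def boundaryWeight (α τ : ℝ) : ℝ := 1 - (stripFun α (τ + Real.pi * I)).arg / Real.pi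

theorem monotone_boundaryWeight (h0 : 0 < α) (h1 : α ≤ 1 / 2) (h2 : 1 / 3 ≤ α) :
    Monotone (boundaryWeight α) := fun x y hxy => by
  have h := antitone_arg_stripFun_top h0 h1 h2 hxy
  have hpi := Real.pi_pos
  rw [boundaryWeight, boundaryWeight]
  gcongr

theorem abs_one_sub_arg_div_le {z : ℂ} (hz : 0 ≤ z.im) : |1 - z.arg / Real.pi| ≤ 1 := by
  have h3 : 0 ≤ z.arg / Real.pi := div_nonneg (arg_nonneg_iff.2 hz) Real.pi_pos.le
  have h4 : z.arg / Real.pi ≤ 1 := div_le_one_of_le₀ (arg_le_pi z) Real.pi_pos.le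
  rw [abs_le]
  constructor <;> linarith

theorem abs_boundaryWeight_le (h0 : 0 < α) (h1 : α ≤ 1 / 2) (h2 : 1 / 3 ≤ α) (τ : ℝ) :
    |boundaryWeight α τ| ≤ 1 :=
  abs_one_sub_arg_div_le (stripFun_top_im_pos h0 h1 h2 τ).le

theorem stripFun_representation (h0 : 0 < α) (h1 : α ≤ 1 / 2) (h2 : 1 / 3 ≤ α) (x : ℝ) :
    Real.log (stripFun α x).re - x - Real.log (stripFun α (0 : ℝ)).re
      = ∫ τ : ℝ, boundaryWeight α τ * (logisticKernel (Real.exp x) τ - logisticKernel 1 τ) := by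
  have hpos := stripFun_ofReal_pos h0 h1 h2
  have hker : Integrable fun τ : ℝ => (1 : ℝ) * (logisticKernel (Real.exp x) τ - logisticKernel 1 τ) :=
    integrable_mul_logisticKernel_sub (ρ := fun _ => 1) (B := 1) measurable_const (by simp)
      (Real.exp_pos x)
  have hcont : Continuous fun τ : ℝ => stripFun α (τ + Real.pi * I) :=
    (differentiable_stripFun h0 h1).continuous.comp (by fun_prop)
  have hlog : ∀ y : ℝ, Tendsto (fun ε : ℝ => Real.log ((stripFun α y).re + ε))
      (nhdsWithin 0 (Ioi 0)) (nhds (Real.log (stripFun α y).re)) := fun y => by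
    have hc : ContinuousAt (fun ε : ℝ => Real.log ((stripFun α y).re + ε)) 0 :=
      ContinuousAt.log (by fun_prop) (by simpa using (hpos y).ne')
    simpa using hc.tendsto.mono_left nhdsWithin_le_nhds
  refine tendsto_nhds_unique (((hlog x).sub_const x).sub (hlog 0)) ?_
  refine Tendsto.congr' (f₁ := fun ε : ℝ => ∫ τ : ℝ,
    (1 - (stripFun α (τ + Real.pi * I) + ε).arg / Real.pi)
      * (logisticKernel (Real.exp x) τ - logisticKernel 1 τ)) ?_ ?_
  · filter_upwards [self_mem_nhdsWithin] with ε hε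
    exact (stripFun_add_representation h0 h1 h2 hε x).symm
  refine tendsto_integral_filter_of_dominated_convergence _ ?_ ?_ hker.norm ?_
  · refine Eventually.of_forall fun ε => Measurable.aestronglyMeasurable ?_
    refine Measurable.mul ?_ ((measurable_logisticKernel _).sub (measurable_logisticKernel _))
    exact measurable_const.sub
      ((measurable_arg.comp (hcont.measurable.add_const _)).div_const _)
  · refine Eventually.of_forall fun ε => ae_of_all _ fun τ => ?_
    rw [norm_mul, norm_mul, norm_one]
    refine mul_le_mul_of_nonneg_right (abs_one_sub_arg_div_le ?_) (norm_nonneg _)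
    rw [add_im, ofReal_im, add_zero]
    exact (stripFun_top_im_pos h0 h1 h2 τ).le
  · refine ae_of_all _ fun τ => Tendsto.mul_const _ ?_
    have hc : ContinuousAt (fun ε : ℝ => 1 - (stripFun α (τ + Real.pi * I) + ε).arg / Real.pi) 0 := by
      refine continuousAt_const.sub (ContinuousAt.div_const ?_ _)
      refine ContinuousAt.comp (g := Complex.arg) ?_ (by fun_prop)
      refine continuousAt_arg (Or.inr ?_)
      simpa using (stripFun_top_im_pos h0 h1 h2 τ).ne'
    simpa [boundaryWeight] using hc.tendsto.mono_left nhdsWithin_le_nhds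

theorem integral_Galpha_eq (h0 : 0 < α) (h1 : α ≤ 1 / 2) {z : ℝ} (hz : 0 < z) :
    Galpha α z = (2 * Real.pi * I)⁻¹ * ((expPowIntegral α (Complex.exp (-(Real.pi * α * I))
      * (z ^ (1 - α) : ℝ)) - expPowIntegral α (Complex.exp (Real.pi * α * I)
      * (z ^ (1 - α) : ℝ))) / z) := by
  rw [Galpha, expPowIntegral, expPowIntegral,
    ← integral_sub (integrableOn_expPow h0 h1 _) (integrableOn_expPow h0 h1 _),
    ← integral_div]
  congr 1
  refine setIntegral_congr_fun measurableSet_Ioi fun y hy => ?_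
  have hy : 0 < y := hy
  have ez : (z : ℂ) ^ (1 - (α : ℂ)) = (z ^ (1 - α) : ℝ) := by
    rw [ofReal_cpow hz.le]
    push_cast
    rfl
  have ey : (y : ℂ) ^ (α : ℂ) = (y ^ α : ℝ) := (ofReal_cpow hy.le _).symm
  simp only [ez, ey, sub_eq_add_neg _ (y : ℂ), Complex.exp_add]
  ring_nf

theorem Galpha_ofReal_eq (h0 : 0 < α) (h1 : α ≤ 1 / 2) {z : ℝ} (hz : 0 < z) :
    Galpha α z = (((stripFun α (Real.log z)).re / (2 * Real.pi * z)
      * Real.exp (-(saddleRate α * z)) : ℝ) : ℂ) := by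
  have hF : ((stripFun α (Real.log z)).re : ℂ) = stripFun α (Real.log z) :=
    (eq_ofReal_of_im_eq_zero (stripFun_ofReal_im _)).symm
  have e : Complex.exp ((1 - α) * (Real.log z : ℝ)) = (z ^ (1 - α) : ℝ) := by
    rw [Real.rpow_def_of_pos hz]
    push_cast
    ring_nf
  have e' : Complex.exp (Real.log z : ℝ) = z := by rw [← ofReal_exp, Real.exp_log hz]
  rw [integral_Galpha_eq h0 h1 hz, ofReal_mul, ofReal_div, hF, stripFun, e, e', ofReal_exp]
  have hne : (z : ℂ) ≠ 0 := ofReal_ne_zero.2 hz.ne'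
  have hpi : (Real.pi : ℂ) ≠ 0 := ofReal_ne_zero.2 Real.pi_ne_zero
  have hc : Complex.exp (saddleRate α * z) * Complex.exp ((-(saddleRate α * z) : ℝ) : ℂ) = 1 := by
    rw [← Complex.exp_add]
    simp
  generalize expPowIntegral α (Complex.exp (-(Real.pi * α * I)) * (z ^ (1 - α) : ℝ))
    - expPowIntegral α (Complex.exp (Real.pi * α * I) * (z ^ (1 - α) : ℝ)) = D
  rw [mul_inv, inv_I]
  calc _ = -I * D / (2 * Real.pi * z) * (Complex.exp (saddleRate α * z)
        * Complex.exp ((-(saddleRate α * z) : ℝ) : ℂ)) := by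
        rw [hc]
        field_simp
    _ = _ := by
        push_cast
        ring

theorem Galpha_re_representation (h0 : 0 < α) (h1 : α ≤ 1 / 2) (h2 : 1 / 3 ≤ α) {z : ℝ}
    (hz : 0 < z) : (Galpha α z).re = (stripFun α (0 : ℝ)).re / (2 * Real.pi)
      * Real.exp (-(saddleRate α * z)
        + ∫ τ : ℝ, boundaryWeight α τ * (logisticKernel z τ - logisticKernel 1 τ)) := by
  have h := stripFun_representation h0 h1 h2 (Real.log z)
  rw [Real.exp_log hz] at h
  have hp := stripFun_ofReal_pos h0 h1 h2
  rw [Galpha_ofReal_eq h0 h1 hz, ofReal_re, ← h, Real.exp_add, Real.exp_sub, Real.exp_sub,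
    Real.exp_log (hp _), Real.exp_log (hp _), Real.exp_log hz]
  have := (hp 0).ne'
  have hpi := Real.pi_ne_zero
  field_simp

end Representation

/-- For `α ∈ [1/3, 1/2]`, `G_α` is positive on `(0,∞)` and is HCM there. -/
theorem Galpha_HCM (α : ℝ) (hα : α ∈ Set.Icc (1/3 : ℝ) (1/2)) :
    (∀ x : ℝ, 0 < x → (Galpha α (x:ℂ)).im = 0 ∧ 0 < (Galpha α (x:ℂ)).re) ∧
    HCM (fun x : ℝ => (Galpha α (x:ℂ)).re) := by
  obtain ⟨h2, h1⟩ := hα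
  have h0 : 0 < α := by linarith
  refine ⟨fun x hx => ?_, ?_⟩
  · rw [Galpha_ofReal_eq h0 h1 hx, ofReal_im, ofReal_re]
    have hp := stripFun_ofReal_pos h0 h1 h2 (Real.log x)
    have hpi := Real.pi_pos
    exact ⟨rfl, by positivity⟩
  · exact hcm_of_representation (monotone_boundaryWeight h0 h1 h2) (abs_boundaryWeight_le h0 h1 h2)
      (saddleRate_nonneg h0 h1) fun z hz => Galpha_re_representation h0 h1 h2 hz
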